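/- Let S be a closed surface, let d₁, d₃ ∈ S be distinct points, let D₂ ⊆ S be a closed disk, and let (Aₙ)ₙ∈ℕ be a cat's cradle between d₁ and d₃ through D₂ such that Aₙ ∩ ∂D₂ is finite for each n (where ∂D₂ is the frontier of D₂ in S). Then there exist a strictly increasing sequence of indices (nᵢ)ᵢ∈ℕ and chords A'_{nᵢ} of D₂ with A'_{nᵢ} ⊆ A_{nᵢ} ∩ D₂ for each i, such that the sequence (A'_{nᵢ})ᵢ∈ℕ is linearly ordered in D₂. -/

import Mathlib

open Set Metric Filter Topology

/-- A space is locally homeomorphic to ℝ²: every point has an open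
neighborhood homeomorphic to the Euclidean plane. -/
def LocallyEuclidean2 (S : Type*) [TopologicalSpace S] : Prop :=
  ∀ x : S, ∃ U : Set S, IsOpen U ∧ x ∈ U ∧
    Nonempty (U ≃ₜ EuclideanSpace ℝ (Fin 2))

section Defs

variable {S : Type*} [TopologicalSpace S]

/-- A continuum: a nonempty compact connected subset. -/
def IsContinuum (X : Set S) : Prop := IsCompact X ∧ IsConnected X

/-- A complementary domain of `X`: a connected component of the complement of `X`. -/
def IsComplementaryDomain (X U : Set S) : Prop :=
  ∃ x, x ∉ X ∧ U = connectedComponentIn Xᶜ x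

/-- A proper subcontinuum of `X`. -/
def IsProperSubcontinuum (X A : Set S) : Prop :=
  A.Nonempty ∧ IsClosed A ∧ IsConnected A ∧ A ⊆ X ∧ A ≠ X

/-- `X` is decomposable: the union of two proper subcontinua. -/
def IsDecomposable (X : Set S) : Prop :=
  ∃ A B, IsProperSubcontinuum X A ∧ IsProperSubcontinuum X B ∧ A ∪ B = X

/-- `X` is the essential union of three proper subcontinua. -/
def IsEssentialUnionOfThree (X : Set S) : Prop :=
  ∃ X₁ X₂ X₃, IsProperSubcontinuum X X₁ ∧ IsProperSubcontinuum X X₂ ∧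
    IsProperSubcontinuum X X₃ ∧ X₁ ∪ X₂ ∪ X₃ = X ∧
    ¬ X₁ ⊆ X₂ ∪ X₃ ∧ ¬ X₂ ⊆ X₁ ∪ X₃ ∧ ¬ X₃ ⊆ X₁ ∪ X₂

/-- `X` is 2-indecomposable: decomposable but not the essential union of
three proper subcontinua. -/
def Is2Indecomposable (X : Set S) : Prop :=
  IsDecomposable X ∧ ¬ IsEssentialUnionOfThree X

/-- `X` is shielded: no complementary domain has frontier equal to `X`. -/
def IsShielded (X : Set S) : Prop :=
  ∀ U, IsComplementaryDomain X U → frontier U ≠ X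

/-- A generalized crosscut of `U`. -/
def IsGenCrosscut (U A : Set S) : Prop :=
  A ⊆ U ∧ Nonempty (A ≃ₜ Set.Ioo (0:ℝ) 1) ∧ closure A \ A ⊆ frontier U

/-- `T` is a shadow of the (generalized) crosscut `A` of `U`. -/
def IsShadowOf (U A T : Set S) : Prop :=
  ∃ x ∈ U \ A, T = closure (connectedComponentIn (U \ A) x) ∩ frontier U

/-- An arc with endpoints `a` and `b`. -/
def IsArcFrom (A : Set S) (a b : S) : Prop :=
  ∃ f : Set.Icc (0:ℝ) 1 → S, Continuous f ∧ Function.Injective f ∧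
    Set.range f = A ∧ f ⟨0, by norm_num⟩ = a ∧ f ⟨1, by norm_num⟩ = b

/-- A crosscut of `U`: a copy of `(0,1)` in `U` whose closure is an arc
meeting the frontier of `U` exactly at the endpoints of the arc. -/
def IsCrosscut (U K : Set S) : Prop :=
  K ⊆ U ∧ Nonempty (K ≃ₜ Set.Ioo (0:ℝ) 1) ∧
    ∃ a b, IsArcFrom (closure K) a b ∧ closure K ∩ frontier U = {a, b}

/-- A closed disk: a set homeomorphic to the closed unit disk in ℝ². -/
def IsClosedDisk (D : Set S) : Prop :=
  Nonempty (D ≃ₜ Metric.closedBall (0 : EuclideanSpace ℝ (Fin 2)) 1)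

/-- A cat's cradle between `d₁` and `d₃`: a family of arcs from `d₁` to `d₃`
whose interiors are pairwise disjoint. -/
def IsCatsCradle {ι : Type*} (d₁ d₃ : S) (A : ι → Set S) : Prop :=
  (∀ i, IsArcFrom (A i) d₁ d₃) ∧
    Pairwise fun i j => (A i \ {d₁, d₃}) ∩ (A j \ {d₁, d₃}) = ∅

/-- A cat's cradle between `d₁` and `d₃` through `D₂`. -/
def IsCatsCradleThrough {ι : Type*} (d₁ d₃ : S) (D₂ : Set S) (A : ι → Set S) : Prop :=
  IsCatsCradle d₁ d₃ A ∧ D₂ ∩ {d₁, d₃} = ∅ ∧ ∀ i, (A i ∩ D₂).Nonempty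

/-- A chord of the closed disk `D`: an arc in `D` meeting the frontier of `D`
exactly at its two endpoints. -/
def IsChord (D A : Set S) : Prop :=
  ∃ a b, IsArcFrom A a b ∧ A ⊆ D ∧ A ∩ frontier D = {a, b}

/-- A sequence of pairwise disjoint chords of `D` is linearly ordered if each
middle chord separates the earlier ones from the later ones in `D`. -/
def LinearlyOrderedChords (D : Set S) (A : ℕ → Set S) : Prop :=
  (Pairwise fun i j => Disjoint (A i) (A j)) ∧
    ∀ i j k, i < j → j < k → ∀ x ∈ A i, ∀ y ∈ A k,
      connectedComponentIn (D \ A j) x ≠ connectedComponentIn (D \ A j) y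

end Defs

section MetricDefs

variable {S : Type*} [MetricSpace S]

/-- Convergence of a sequence of sets to `X` in the Hausdorff metric. -/
def HausdorffConvergesTo (A : ℕ → Set S) (X : Set S) : Prop :=
  Tendsto (fun n => hausdorffDist (A n) X) atTop (𝓝 0)

/-- The double-pass condition for a sequence of domains. -/
def DoublePassCondition (X : Set S) (U : ℕ → Set S) : Prop :=
  ∀ K : ℕ → Set S, (∀ n, IsGenCrosscut (U n) (K n)) →
    ∃ Sh : ℕ → Set S, (∀ n, IsShadowOf (U n) (K n) (Sh n)) ∧ HausdorffConvergesTo Sh X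

/-- The double-pass condition with (genuine) crosscuts. -/
def DoublePassConditionCrosscuts (X : Set S) (U : ℕ → Set S) : Prop :=
  ∀ K : ℕ → Set S, (∀ n, IsCrosscut (U n) (K n)) →
    ∃ Sh : ℕ → Set S, (∀ n, IsShadowOf (U n) (K n) (Sh n)) ∧ HausdorffConvergesTo Sh X

end MetricDefs

/-! ### Alexander–Spanier style cocycles with values in `ZMod 2` -/

namespace Cradle

/-- `E` is additive near `p`. -/
def AddAt {X : Type*} [TopologicalSpace X] (E : X → X → ZMod 2) (p : X) : Prop :=
  ∃ V ∈ 𝓝 p, ∀ x ∈ V, ∀ y ∈ V, ∀ z ∈ V, E x y + E y z = E x z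

/-- `E` is the coboundary of `u` near `p`. -/
def TrivAt {X : Type*} [TopologicalSpace X] (E : X → X → ZMod 2) (u : X → ZMod 2) (p : X) : Prop :=
  ∃ V ∈ 𝓝 p, ∀ x ∈ V, ∀ y ∈ V, E x y = u x + u y

/-- `h` is constant near `p`. -/
def LC {X : Type*} [TopologicalSpace X] (h : X → ZMod 2) (p : X) : Prop :=
  ∀ᶠ y in 𝓝 p, h y = h p

section basics
variable {X Y : Type*} [TopologicalSpace X] [TopologicalSpace Y]

lemma TrivAt.addAt {E : X → X → ZMod 2} {u : X → ZMod 2} {p : X} (h : TrivAt E u p) :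
    AddAt E p := by
  obtain ⟨V, hV, h⟩ := h
  refine ⟨V, hV, fun x hx y hy z hz => ?_⟩
  rw [h x hx y hy, h y hy z hz, h x hx z hz]; grind

lemma AddAt.trivAt {E : X → X → ZMod 2} {p : X} (h : AddAt E p) : TrivAt E (E p) p := by
  obtain ⟨V, hV, h⟩ := h
  have hp := mem_of_mem_nhds hV
  refine ⟨V, hV, fun x hx y hy => ?_⟩
  have := h p hp x hx y hy
  grind

lemma TrivAt.add {E E' : X → X → ZMod 2} {u u' : X → ZMod 2} {p : X} (h : TrivAt E u p)
    (h' : TrivAt E' u' p) : TrivAt (fun x y => E x y + E' x y) (fun x => u x + u' x) p := by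
  obtain ⟨V, hV, h⟩ := h
  obtain ⟨V', hV', h'⟩ := h'
  refine ⟨V ∩ V', inter_mem hV hV', fun x hx y hy => ?_⟩
  have := h x hx.1 y hy.1
  have := h' x hx.2 y hy.2
  grind

lemma AddAt.add {E E' : X → X → ZMod 2} {p : X} (h : AddAt E p)
    (h' : AddAt E' p) : AddAt (fun x y => E x y + E' x y) p :=
  (h.trivAt.add h'.trivAt).addAt

lemma TrivAt.comp {E : X → X → ZMod 2} {u : X → ZMod 2} {f : Y → X} {y : Y}
    (h : TrivAt E u (f y)) (hf : ContinuousAt f y) :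
    TrivAt (fun a b => E (f a) (f b)) (fun a => u (f a)) y := by
  obtain ⟨V, hV, h⟩ := h
  exact ⟨f ⁻¹' V, hf hV, fun a ha b hb => h _ ha _ hb⟩

lemma AddAt.comp {E : X → X → ZMod 2} {f : Y → X} {y : Y}
    (h : AddAt E (f y)) (hf : ContinuousAt f y) :
    AddAt (fun a b => E (f a) (f b)) y := (h.trivAt.comp hf).addAt

lemma TrivAt.congrE {E E' : X → X → ZMod 2} {u : X → ZMod 2} {p : X} (h : TrivAt E u p)
    (h' : ∃ V ∈ 𝓝 p, ∀ x ∈ V, ∀ y ∈ V, E' x y = E x y) : TrivAt E' u p := by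
  obtain ⟨V, hV, h⟩ := h
  obtain ⟨V', hV', h'⟩ := h'
  exact ⟨V ∩ V', inter_mem hV hV', fun x hx y hy => by
    rw [h' x hx.2 y hy.2, h x hx.1 y hy.1]⟩

lemma TrivAt.congru {E : X → X → ZMod 2} {u u' : X → ZMod 2} {p : X} (h : TrivAt E u p)
    (h' : LC (fun x => u x + u' x) p) : TrivAt E u' p := by
  obtain ⟨V, hV, h⟩ := h
  refine ⟨_, inter_mem hV h', fun x hx y hy => ?_⟩
  have := h x hx.1 y hy.1
  have h1 := hx.2
  have h2 := hy.2
  simp only [mem_ofPred_eq] at h1 h2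
  grind

lemma TrivAt.lc {E : X → X → ZMod 2} {u u' : X → ZMod 2} {p : X} (h : TrivAt E u p)
    (h' : TrivAt E u' p) : LC (fun x => u x + u' x) p := by
  obtain ⟨V, hV, h⟩ := h
  obtain ⟨V', hV', h'⟩ := h'
  filter_upwards [hV, hV'] with x hx hx'
  have := h x hx p (mem_of_mem_nhds hV)
  have := h' x hx' p (mem_of_mem_nhds hV')
  grind

lemma trivAt_zero_iff {u : X → ZMod 2} {p : X} : TrivAt (fun _ _ => 0) u p ↔ LC u p := by
  constructor
  · rintro ⟨V, hV, h⟩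
    filter_upwards [hV] with x hx
    have := h x hx p (mem_of_mem_nhds hV)
    grind
  · intro h
    refine ⟨_, h, fun x hx y hy => ?_⟩
    simp only [mem_ofPred_eq] at hx hy
    grind

lemma LC.const_on {h : X → ZMod 2} {T : Set X} (hT : IsPreconnected T)
    (hh : ∀ p ∈ T, LC h p) {x y : X} (hx : x ∈ T) (hy : y ∈ T) : h x = h y := by
  refine hT.constant (f := h) ?_ hx hy
  intro p hp
  refine ContinuousAt.continuousWithinAt ?_
  exact continuousAt_const.congr (f := fun _ => h p) ((hh p hp).mono fun y hy => hy.symm)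

lemma LC.comp {h : X → ZMod 2} {f : Y → X} {y : Y} (hh : LC h (f y)) (hf : ContinuousAt f y) :
    LC (fun a => h (f a)) y := hf.eventually hh

lemma LC.eventually {h : X → ZMod 2} {p : X} (hh : LC h p) : ∀ᶠ q in 𝓝 p, LC h q := by
  have := eventually_eventually_nhds.2 hh
  filter_upwards [this, hh] with q hq h1
  unfold LC
  filter_upwards [hq] with y hy
  rw [hy, h1]

/-- Pull a trivialisation from an open subtype to the ambient space. -/
lemma TrivAt.of_subtype {U : Set X} (hU : IsOpen U) {E : X → X → ZMod 2} {u : U → ZMod 2}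
    {u' : X → ZMod 2} (huu : ∀ x : U, u' x = u x) {p : U}
    (h : TrivAt (fun a b : U => E a b) u p) : TrivAt E u' (p : X) := by
  obtain ⟨V, hV, h⟩ := h
  refine ⟨Subtype.val '' V, ?_, ?_⟩
  · exact (hU.isOpenEmbedding_subtypeVal.image_mem_nhds).2 hV
  · rintro _ ⟨x, hx, rfl⟩ _ ⟨y, hy, rfl⟩
    rw [huu, huu]; exact h x hx y hy

end basics

/-- Every cocycle on the unit interval is trivial. -/
lemma interval_triv (E : unitInterval → unitInterval → ZMod 2) (hE : ∀ t, AddAt E t) :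
    ∃ u : unitInterval → ZMod 2, ∀ t, TrivAt E u t := by
  choose V hV hVE using hE
  obtain ⟨t, ht0, htm, ⟨N, hN⟩, htc⟩ := exists_monotone_Icc_subset_open_cover_unitInterval
    (c := fun i => interior (V i)) (fun i => isOpen_interior)
    (fun x _ => mem_iUnion.2 ⟨x, mem_interior_iff_mem_nhds.2 (hV x)⟩)
  have key : ∀ n, ∃ u : unitInterval → ZMod 2, ∀ s ≤ t n, ∃ W ∈ 𝓝 s, ∀ x ∈ W, ∀ y ∈ W,
      x ≤ t n → y ≤ t n → E x y = u x + u y := by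
    intro n
    induction n with
    | zero =>
      refine ⟨fun _ => 0, fun s hs => ⟨univ, univ_mem, fun x _ y _ hx hy => ?_⟩⟩
      rw [ht0] at hx hy
      have hx : x = 0 := le_antisymm hx unitInterval.nonneg'
      have hy : y = 0 := le_antisymm hy unitInterval.nonneg'
      subst hx; subst hy
      have := hVE 0 0 (mem_of_mem_nhds (hV 0)) 0 (mem_of_mem_nhds (hV 0)) 0 (mem_of_mem_nhds (hV 0))
      grind
    | succ n ih =>
      obtain ⟨u, hu⟩ := ih
      obtain ⟨i, hi⟩ := htc n
      have hmem : ∀ x, t n ≤ x → x ≤ t (n+1) → x ∈ V i := fun x h1 h2 => interior_subset (hi ⟨h1, h2⟩)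
      have htn := hmem (t n) le_rfl (htm (Nat.le_succ n))
      refine ⟨fun x => if x ≤ t n then u x else u (t n) + E (t n) x, fun s hs => ?_⟩
      rcases lt_trichotomy s (t n) with h | h | h
      · obtain ⟨W, hW, hWu⟩ := hu s h.le
        refine ⟨W ∩ Iio (t n), inter_mem hW (Iio_mem_nhds h), fun x hx y hy _ _ => ?_⟩
        have h1 : x ≤ t n := le_of_lt hx.2
        have h2 : y ≤ t n := le_of_lt hy.2
        simp only [h1, h2, if_true]
        exact hWu x hx.1 y hy.1 h1 h2
      · obtain ⟨W, hW, hWu⟩ := hu s h.le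
        have hsW := mem_of_mem_nhds hW
        refine ⟨W ∩ interior (V i), inter_mem hW (isOpen_interior.mem_nhds
          (h ▸ hi ⟨le_rfl, htm (Nat.le_succ n)⟩)), fun x hx y hy hx' hy' => ?_⟩
        subst h
        have hxV := interior_subset hx.2
        have hyV := interior_subset hy.2
        have e1 := hVE i x hxV _ htn y hyV
        have e2 := hVE i y hyV _ htn x hxV
        have e3 := hVE i _ htn _ htn _ htn
        have e4 := hVE i x hxV _ htn _ htn
        have e5 := hVE i _ htn x hxV _ htn
        have e6 := hVE i _ htn y hyV _ htn
        by_cases h1 : x ≤ t n <;> by_cases h2 : y ≤ t n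
        · simp only [h1, h2, if_true]
          exact hWu x hx.1 y hy.1 h1 h2
        · simp only [h1, h2, if_true, if_false]
          have := hWu x hx.1 _ hsW h1 le_rfl
          grind
        · simp only [h1, h2, if_true, if_false]
          have := hWu _ hsW y hy.1 le_rfl h2
          grind
        · simp only [h1, h2, if_false]
          grind
      · refine ⟨Ioi (t n), Ioi_mem_nhds h, fun x hx y hy hx' hy' => ?_⟩
        have h1 : ¬ x ≤ t n := not_le.2 hx
        have h2 : ¬ y ≤ t n := not_le.2 hy
        simp only [h1, h2, if_false]
        have hxV := hmem x (le_of_lt hx) hx'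
        have hyV := hmem y (le_of_lt hy) hy'
        have e1 := hVE i _ htn x hxV y hyV
        grind
  obtain ⟨u, hu⟩ := key N
  refine ⟨u, fun s => ?_⟩
  rw [hN N le_rfl] at hu
  obtain ⟨W, hW, h⟩ := hu s unitInterval.le_one'
  exact ⟨W, hW, fun x hx y hy => h x hx y hy unitInterval.le_one' unitInterval.le_one'⟩

/-- Homotopy lemma: on `X × I` a cocycle is cohomologous to the pull-back of its restriction
to `X × {0}`. -/
lemma homotopy_lemma {X : Type*} [TopologicalSpace X]
    (E : X × unitInterval → X × unitInterval → ZMod 2) (hE : ∀ p, AddAt E p) :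
    ∃ u : X × unitInterval → ZMod 2, ∀ p,
      TrivAt (fun a b => E a b + E (a.1, 0) (b.1, 0)) u p := by
  have h1 : ∀ x : X, ∃ u : unitInterval → ZMod 2, u 0 = 0 ∧
      ∀ t, TrivAt (fun a b => E (x, a) (x, b)) u t := by
    intro x
    obtain ⟨u, hu⟩ := interval_triv (fun a b => E (x, a) (x, b))
      (fun t => (hE (x, t)).comp (f := fun a => (x, a)) (by fun_prop))
    refine ⟨fun t => u t + u 0, by grind, fun t => (hu t).congru ?_⟩
    refine Eventually.of_forall fun y => ?_
    grind
  choose u hu0 hu using h1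
  refine ⟨fun p => u p.1 p.2, ?_⟩
  suffices H : ∀ x : X, ∀ t : unitInterval,
      TrivAt (fun a b => E a b + E (a.1, 0) (b.1, 0)) (fun p => u p.1 p.2) (x, t) from
    fun p => H p.1 p.2
  intro x
  -- local propagation
  have loc : ∀ t : unitInterval, ∃ N ∈ 𝓝 t, ∃ W ∈ 𝓝 x, (∀ a ∈ W, ∀ b ∈ W, ∀ c ∈ W,
      ∀ s ∈ N, ∀ s' ∈ N, ∀ s'' ∈ N, E (a, s) (b, s') + E (b, s') (c, s'') = E (a, s) (c, s'')) ∧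
      (∀ a ∈ W, ∀ s ∈ N, ∀ s' ∈ N, E (a, s) (a, s') = u a s + u a s') := by
    intro t
    obtain ⟨V, hV, hVE⟩ := hE (x, t)
    rw [nhds_prod_eq, mem_prod_iff] at hV
    obtain ⟨W, hW, N0, hN0, hWN⟩ := hV
    obtain ⟨b, c, htbc, hN, hNN⟩ := exists_Icc_mem_subset_of_mem_nhds (interior_mem_nhds.2 hN0)
    have hNN' : Icc b c ⊆ N0 := hNN.trans interior_subset
    refine ⟨Icc b c, hN, W, hW, fun a ha b hb c hc s hs s' hs' s'' hs'' =>
      hVE _ (hWN ⟨ha, hNN' hs⟩) _ (hWN ⟨hb, hNN' hs'⟩) _ (hWN ⟨hc, hNN' hs''⟩), ?_⟩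
    intro a ha s hs s' hs'
    have hc := LC.const_on (h := fun r => E (a, s) (a, r) + u a r) (T := Icc b c) isPreconnected_Icc ?_
      hs hs'
    · have e1 := hVE (a, s) (hWN ⟨ha, hNN' hs⟩) (a, s) (hWN ⟨ha, hNN' hs⟩) (a, s) (hWN ⟨ha, hNN' hs⟩)
      grind
    · intro r hr
      obtain ⟨M, hM, hMu⟩ := hu a r
      have hrM := mem_of_mem_nhds hM
      unfold LC
      filter_upwards [hM, isOpen_interior.mem_nhds (hNN hr)] with q hq hq'
      have e1 := hMu q hq r hrM
      have e2 := hVE (a, s) (hWN ⟨ha, hNN' hs⟩) (a, q) (hWN ⟨ha, interior_subset hq'⟩) (a, r) (hWN ⟨ha, hNN' hr⟩)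
      simp only at e1 e2
      grind
  have prop : ∀ t : unitInterval, ∃ N ∈ 𝓝 t, ∀ s0 ∈ N, ∀ s ∈ N,
      TrivAt (fun a b => E a b + E (a.1, 0) (b.1, 0)) (fun p => u p.1 p.2) (x, s0) →
      TrivAt (fun a b => E a b + E (a.1, 0) (b.1, 0)) (fun p => u p.1 p.2) (x, s) := by
    intro t
    obtain ⟨N, hN, W, hW, hadd, hEu⟩ := loc t
    refine ⟨interior N, interior_mem_nhds.2 hN, ?_⟩
    rintro s0 hs0 s hs ⟨V, hV, hVE⟩
    rw [nhds_prod_eq, mem_prod_iff] at hV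
    obtain ⟨W', hW', N', hN', hWN⟩ := hV
    refine ⟨(W ∩ W') ×ˢ N, prod_mem_nhds (inter_mem hW hW')
      (mem_interior_iff_mem_nhds.1 hs), ?_⟩
    rintro ⟨a, r⟩ ⟨⟨haW, haW'⟩, hr⟩ ⟨b, r'⟩ ⟨⟨hbW, hbW'⟩, hr'⟩
    have h0 := interior_subset hs0
    have e1 := hVE (a, s0) (hWN ⟨haW', mem_of_mem_nhds hN'⟩) (b, s0)
      (hWN ⟨hbW', mem_of_mem_nhds hN'⟩)
    have e2 := hadd a haW a haW b hbW r hr s0 h0 r' hr'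
    have e3 := hadd a haW b hbW b hbW s0 h0 s0 h0 r' hr'
    have e4 := hEu a haW r hr s0 h0
    have e5 := hEu b hbW s0 h0 r' hr'
    simp only at *
    grind
  have h0 : TrivAt (fun a b => E a b + E (a.1, 0) (b.1, 0)) (fun p => u p.1 p.2) (x, 0) := by
    obtain ⟨N, hN, W, hW, hadd, hEu⟩ := loc 0
    refine ⟨W ×ˢ N, prod_mem_nhds hW hN, ?_⟩
    rintro ⟨a, r⟩ ⟨haW, hr⟩ ⟨b, r'⟩ ⟨hbW, hr'⟩
    have h0 := mem_of_mem_nhds hN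
    have e2 := hadd a haW a haW b hbW r hr 0 h0 r' hr'
    have e3 := hadd a haW b hbW b hbW 0 h0 0 h0 r' hr'
    have e4 := hEu a haW r hr 0 h0
    have e5 := hEu b hbW 0 h0 r' hr'
    have e6 := hu0 a
    have e7 := hu0 b
    simp only at *
    grind
  classical
  intro t
  have hc := LC.const_on (h := fun s : unitInterval => if
    TrivAt (fun a b => E a b + E (a.1, 0) (b.1, 0)) (fun p => u p.1 p.2) (x, s) then (1 : ZMod 2)
    else 0) (T := univ) isPreconnected_univ ?_ (mem_univ 0) (mem_univ t)
  · simp only [h0, if_true] at hc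
    by_contra hcon
    simp [hcon] at hc
  · intro r _
    obtain ⟨N, hN, hNP⟩ := prop r
    unfold LC
    filter_upwards [hN] with s hs
    have hr := mem_of_mem_nhds hN
    have : TrivAt (fun a b => E a b + E (a.1, 0) (b.1, 0)) (fun p => u p.1 p.2) (x, s) ↔
      TrivAt (fun a b => E a b + E (a.1, 0) (b.1, 0)) (fun p => u p.1 p.2) (x, r) :=
      ⟨hNP s hs r hr, hNP r hr s hs⟩
    simp only [this]

/-- Homotopic maps pull back a cocycle to cohomologous cocycles. -/
lemma homotopy_triv {X Y : Type*} [TopologicalSpace X] [TopologicalSpace Y]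
    (E : Y → Y → ZMod 2) (H : X × unitInterval → Y) (hH : Continuous H)
    (hE : ∀ p, AddAt E (H p)) :
    ∃ u : X → ZMod 2, ∀ x, TrivAt (fun a b => E (H (a, 1)) (H (b, 1)) + E (H (a, 0)) (H (b, 0)))
      u x := by
  obtain ⟨u, hu⟩ := homotopy_lemma (fun a b => E (H a) (H b)) (fun p => (hE p).comp hH.continuousAt)
  exact ⟨fun x => u (x, 1), fun x => (hu (x, 1)).comp (f := fun x => (x, (1 : unitInterval)))
    (by fun_prop)⟩

lemma homotopy_triv_iff {X Y : Type*} [TopologicalSpace X] [TopologicalSpace Y]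
    (E : Y → Y → ZMod 2) (H : X × unitInterval → Y) (hH : Continuous H)
    (hE : ∀ p, AddAt E (H p)) :
    (∃ u : X → ZMod 2, ∀ x, TrivAt (fun a b => E (H (a, 1)) (H (b, 1))) u x) ↔
    (∃ u : X → ZMod 2, ∀ x, TrivAt (fun a b => E (H (a, 0)) (H (b, 0))) u x) := by
  obtain ⟨u, hu⟩ := homotopy_triv E H hH hE
  constructor
  · rintro ⟨v, hv⟩
    refine ⟨_, fun x => ((hu x).add (hv x)).congrE ⟨univ, univ_mem, fun x _ y _ => ?_⟩⟩
    grind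
  · rintro ⟨v, hv⟩
    refine ⟨_, fun x => ((hu x).add (hv x)).congrE ⟨univ, univ_mem, fun x _ y _ => ?_⟩⟩
    grind

/-- Cocycles pulled back along a null-homotopic map are trivial. -/
lemma contr_triv {X Y : Type*} [TopologicalSpace X] [TopologicalSpace Y]
    (E : Y → Y → ZMod 2) (H : X × unitInterval → Y) (hH : Continuous H)
    (hE : ∀ p, AddAt E (H p)) (y0 : Y) (h0 : ∀ x, H (x, 0) = y0) :
    ∃ u : X → ZMod 2, ∀ x, TrivAt (fun a b => E (H (a, 1)) (H (b, 1))) u x := by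
  refine (homotopy_triv_iff E H hH hE).2 ⟨fun _ => 0, fun x => ?_⟩
  have hy : AddAt E y0 := h0 x ▸ hE (x, 0)
  refine ⟨univ, univ_mem, fun a _ b _ => ?_⟩
  obtain ⟨V, hV, h⟩ := hy
  have h1 := mem_of_mem_nhds hV
  have := h y0 h1 y0 h1 y0 h1
  simp only [h0]
  grind

/-- A cocycle on a set that is star-shaped in a real topological vector space is trivial. -/
lemma star_triv {V : Type*} [AddCommGroup V] [Module ℝ V] [TopologicalSpace V]
    [IsTopologicalAddGroup V] [ContinuousSMul ℝ V] {K : Set V} {c : V} (hc : c ∈ K)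
    (hK : StarConvex ℝ c K)
    (E : K → K → ZMod 2) (hE : ∀ p, AddAt E p) :
    ∃ u : K → ZMod 2, ∀ x, TrivAt E u x := by
  have hm : ∀ p : K × unitInterval, c + (p.2 : ℝ) • ((p.1 : V) - c) ∈ K := by
    intro p
    have := hK p.1.2 (a := 1 - (p.2 : ℝ)) (b := p.2) (by linarith [p.2.2.2]) p.2.2.1 (by ring)
    convert this using 1
    module
  obtain ⟨u, hu⟩ := contr_triv E (fun p : K × unitInterval =>
    (⟨c + (p.2 : ℝ) • ((p.1 : V) - c), hm p⟩ : K)) (by fun_prop) (fun p => hE _) ⟨c, hc⟩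
    (by intro x; simp)
  refine ⟨u, fun x => ?_⟩
  simpa using hu x

end Cradle

namespace Cradle

/-- A (discontinuous) complex square root. -/
noncomputable def rt (w : ℂ) : ℂ := w ^ (((2 : ℕ) : ℂ)⁻¹)

lemma rt_sq (w : ℂ) : rt w ^ 2 = w := Complex.cpow_nat_inv_pow w two_ne_zero

lemma rt_one : rt 1 = 1 := by simp [rt]

lemma rt_cont {w : ℂ} (hw : w ∈ Complex.slitPlane) : ContinuousAt rt w :=
  continuousAt_cpow_const hw

open Classical in
/-- The square root cocycle. -/
noncomputable def Q (x y : ℂ) : ZMod 2 := if 0 < (rt x * (starRingEnd ℂ) (rt y)).re then 0 else 1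

open Classical in
lemma sqrt_triv {X : Type*} [TopologicalSpace X] {φ ψ : X → ℂ} {p : X} (hψ : ContinuousAt ψ p)
    (h : ∀ᶠ x in 𝓝 p, ψ x ^ 2 = φ x) (h0 : φ p ≠ 0) :
    TrivAt (fun a b => Q (φ a) (φ b)) (fun x => if rt (φ x) = ψ x then 0 else 1) p := by
  have hp : ψ p ≠ 0 := by
    intro hh
    have := h.self_of_nhds
    rw [hh] at this
    exact h0 (by rw [← this]; simp)
  have hc : ContinuousAt (fun q : X × X => (ψ q.1 * (starRingEnd ℂ) (ψ q.2)).re) (p, p) := by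
    have h1 : ContinuousAt (fun q : X × X => ψ q.1) (p, p) :=
      ContinuousAt.comp (f := Prod.fst) (g := ψ) hψ continuousAt_fst
    have h2 : ContinuousAt (fun q : X × X => ψ q.2) (p, p) :=
      ContinuousAt.comp (f := Prod.snd) (g := ψ) hψ continuousAt_snd
    exact Complex.continuous_re.continuousAt.comp (h1.mul
      (Complex.continuous_conj.continuousAt.comp h2))
  have hpos : 0 < (ψ p * (starRingEnd ℂ) (ψ p)).re := by
    rw [Complex.mul_conj, Complex.ofReal_re]
    exact Complex.normSq_pos.2 hp
  have hev := hc.eventually (lt_mem_nhds hpos)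
  rw [nhds_prod_eq] at hev
  obtain ⟨A, hA, B, hB, hAB⟩ := mem_prod_iff.1 hev
  refine ⟨A ∩ B ∩ _, inter_mem (inter_mem hA hB) h, ?_⟩
  rintro x ⟨⟨hxA, hxB⟩, hx⟩ y ⟨⟨hyA, hyB⟩, hy⟩
  have hxy : 0 < (ψ x * (starRingEnd ℂ) (ψ y)).re := hAB (mk_mem_prod hxA hyB)
  simp only [mem_ofPred_eq] at hx hy
  have ex : rt (φ x) = ψ x ∨ rt (φ x) = - ψ x := by
    rw [← sq_eq_sq_iff_eq_or_eq_neg, rt_sq, hx]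
  have ey : rt (φ y) = ψ y ∨ rt (φ y) = - ψ y := by
    rw [← sq_eq_sq_iff_eq_or_eq_neg, rt_sq, hy]
  have nx : ψ x ≠ 0 := by intro hh; simp [hh] at hxy
  have ny : ψ y ≠ 0 := by intro hh; simp [hh] at hxy
  have nx' : - ψ x ≠ ψ x := by intro hh; exact nx (by linear_combination -(1/2) * hh)
  have ny' : - ψ y ≠ ψ y := by intro hh; exact ny (by linear_combination -(1/2) * hh)
  unfold Q
  beta_reduce
  rcases ex with ex | ex <;> rcases ey with ey | ey
  · rw [ex, ey]; simp only [if_true, if_pos hxy]; rfl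
  · rw [ex, ey, map_neg, mul_neg, Complex.neg_re, if_neg (by linarith), if_pos rfl, if_neg ny']; rfl
  · rw [ex, ey, neg_mul, Complex.neg_re, if_neg (by linarith), if_pos rfl, if_neg nx']; rfl
  · rw [ex, ey, map_neg, neg_mul_neg, if_pos hxy, if_neg nx', if_neg ny']; rfl

/-- the local continuous square root near `p`. -/
lemma local_root {p : ℂ} (hp : p ≠ 0) : ContinuousAt (fun x => rt p * rt (x / p)) p ∧
    ∀ x, (rt p * rt (x / p)) ^ 2 = x := by
  constructor
  · refine continuousAt_const.mul ?_
    refine ContinuousAt.comp (g := rt) (f := fun x => x / p) (rt_cont ?_) (by fun_prop)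
    rw [div_self hp]; exact Complex.one_mem_slitPlane
  · intro x
    rw [mul_pow, rt_sq, rt_sq]; field_simp

lemma Q_addAt {p : ℂ} (hp : p ≠ 0) : AddAt Q p := by
  classical
  obtain ⟨h1, h2⟩ := local_root hp
  exact (sqrt_triv (φ := id) h1 (Eventually.of_forall h2) hp).addAt

lemma sqrt_of_triv {X : Type*} [TopologicalSpace X] {φ : X → ℂ} (hφ : Continuous φ)
    (h0 : ∀ x, φ x ≠ 0) {u : X → ZMod 2} (hu : ∀ x, TrivAt (fun a b => Q (φ a) (φ b)) u x) :
    ∃ ψ : X → ℂ, Continuous ψ ∧ ∀ x, ψ x ^ 2 = φ x := by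
  classical
  refine ⟨fun x => if u x = 0 then rt (φ x) else - rt (φ x), ?_, ?_⟩
  · rw [continuous_iff_continuousAt]
    intro p
    obtain ⟨h1, h2⟩ := local_root (h0 p)
    have h3 : ContinuousAt (fun x => rt (φ p) * rt (φ x / φ p)) p :=
      ContinuousAt.comp (g := fun x => rt (φ p) * rt (x / φ p)) (f := φ) h1 hφ.continuousAt
    have h4 := sqrt_triv (φ := φ) h3 (Eventually.of_forall fun x => h2 (φ x)) (h0 p)
    have h5 := (hu p).lc h4
    unfold LC at h5
    have key : ∀ x, (if u x = 0 then rt (φ x) else - rt (φ x)) =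
      if (u x + if rt (φ x) = rt (φ p) * rt (φ x / φ p) then 0 else 1) = 0 then
        rt (φ p) * rt (φ x / φ p) else - (rt (φ p) * rt (φ x / φ p)) := by
      intro x
      have ex : rt (φ x) = rt (φ p) * rt (φ x / φ p) ∨ rt (φ x) = - (rt (φ p) * rt (φ x / φ p)) := by
        rw [← sq_eq_sq_iff_eq_or_eq_neg, rt_sq, h2]
      have hu01 : ∀ a : ZMod 2, a = 0 ∨ a = 1 := by decide
      have h11 : (1 : ZMod 2) + 1 = 0 := by decide
      rcases hu01 (u x) with hh | hh <;> by_cases hr : rt (φ x) = rt (φ p) * rt (φ x / φ p)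
      · simp only [hh, hr, if_true]; simp
      · have hr' := ex.resolve_left hr
        rw [hh, if_pos rfl, if_neg hr, if_neg (by decide), hr']
      · rw [hh, if_neg (by decide), if_pos hr, if_neg (by decide)]; rw [← hr]
      · have hr' := ex.resolve_left hr
        rw [hh, if_neg (by decide), if_neg hr, if_pos h11, hr', neg_neg]
    have h6 : ContinuousAt (fun x => if (u p + if rt (φ p) = rt (φ p) * rt (φ p / φ p) then 0
        else 1) = 0 then
        rt (φ p) * rt (φ x / φ p) else - (rt (φ p) * rt (φ x / φ p))) p := by
      split_ifs
      · exact h3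
      · exact h3.neg
      · exact h3
      · exact h3.neg
    refine h6.congr ?_
    filter_upwards [h5] with x hx
    rw [key x, hx]
  · intro x
    simp only
    split_ifs
    · exact rt_sq _
    · rw [neg_sq]; exact rt_sq _

/-- The unit circle. -/
abbrev Circ : Type := sphere (0 : ℂ) 1

instance : PreconnectedSpace Circ :=
  Subtype.preconnectedSpace (isPreconnected_sphere (by simp [Complex.rank_real_complex]) _ _)

lemma odd_nontriv {φ : Circ → ℂ} (hφ : Continuous φ) (h0 : ∀ x, φ x ≠ 0)
    (hodd : ∀ x, φ (-x) = - φ x) :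
    ¬ ∃ u : Circ → ZMod 2, ∀ x, TrivAt (fun a b => Q (φ a) (φ b)) u x := by
  rintro ⟨u, hu⟩
  obtain ⟨ψ, hψ, hs⟩ := sqrt_of_triv hφ h0 hu
  have hψ0 : ∀ x, ψ x ≠ 0 := by
    intro x hx
    have := hs x
    rw [hx] at this
    exact h0 x (by rw [← this]; simp)
  set g : Circ → ℂ := fun x => ψ (-x) / ψ x with hg
  have hgc : Continuous g := (hψ.comp continuous_neg).div hψ hψ0
  have hg2 : ∀ x, g x = Complex.I ∨ g x = - Complex.I := by
    intro x
    rw [← sq_eq_sq_iff_eq_or_eq_neg, hg]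
    simp only
    rw [div_pow, hs, hs, hodd, neg_div, div_self (h0 x), Complex.I_sq]
  have hgg : ∀ x, g (-x) * g x = 1 := by
    intro x
    simp only [hg, neg_neg]
    have := hψ0 x
    have := hψ0 (-x)
    field_simp
  have him : Continuous fun x => (g x).im := Complex.continuous_im.comp hgc
  have hm : (0 : ℝ) ∈ range fun x => (g x).im := by
    have x0 : Circ := ⟨1, by simp⟩
    have h1 := hgg x0
    apply mem_range_of_exists_le_of_exists_ge him
    · rcases hg2 x0 with h | h
      · refine ⟨-x0, ?_⟩
        rcases hg2 (-x0) with h' | h'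
        · rw [h, h'] at h1; norm_num at h1
        · rw [h']; simp
      · exact ⟨x0, by rw [h]; simp⟩
    · rcases hg2 x0 with h | h
      · exact ⟨x0, by rw [h]; simp⟩
      · refine ⟨-x0, ?_⟩
        rcases hg2 (-x0) with h' | h'
        · rw [h']; simp
        · rw [h, h'] at h1; norm_num at h1
  obtain ⟨x, hx⟩ := hm
  simp only at hx
  rcases hg2 x with h | h <;> rw [h] at hx <;> simp at hx

end Cradle

namespace Cradle

lemma Circ.norm (c : Circ) : ‖(c : ℂ)‖ = 1 := by simpa using c.2

/-- Two-dimensional invariance of domain at the centre of a disc. -/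
lemma invdom {F : ℂ → ℂ} (hF : ContinuousOn F (closedBall 0 1)) (hi : InjOn F (closedBall 0 1))
    (h0 : F 0 = 0) : F '' closedBall 0 1 ∈ 𝓝 (0 : ℂ) := by
  by_contra hcon
  have hz : (0 : ℂ) ∈ closedBall (0 : ℂ) 1 := by simp
  obtain ⟨c0, hc0, hmin⟩ := (isCompact_sphere (0 : ℂ) 1).exists_isMinOn
    (f := fun c => ‖F c‖) ⟨1, by simp⟩ (hF.mono sphere_subset_closedBall).norm
  have hm : 0 < ‖F c0‖ := by
    rw [norm_pos_iff]
    intro h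
    have := hi (sphere_subset_closedBall hc0) hz (h.trans h0.symm)
    simp [this] at hc0
  have hball : ¬ ball 0 ‖F c0‖ ⊆ F '' closedBall 0 1 := fun h =>
    hcon (mem_of_superset (ball_mem_nhds _ hm) h)
  obtain ⟨w, hw, hwF⟩ := not_subset.1 hball
  rw [mem_ball_zero_iff] at hw
  have hb : ∀ (c : Circ) (t : ℂ), ‖t‖ ≤ 1 → t * c ∈ closedBall (0 : ℂ) 1 := by
    intro c t ht
    rw [mem_closedBall_zero_iff, norm_mul, Circ.norm, mul_one]; exact ht
  have hI : ∀ t : unitInterval, ‖((t : ℝ) : ℂ)‖ ≤ 1 := by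
    intro t
    rw [Complex.norm_real, Real.norm_of_nonneg t.2.1]; exact t.2.2
  have hcR : Continuous fun p : Circ × unitInterval => (((p.2 : ℝ) : ℂ)) := by fun_prop
  have hden : ∀ t : unitInterval, (1 + ((t : ℝ) : ℂ)) ≠ 0 := by
    intro t h
    have := congrArg Complex.re h
    simp at this
    linarith [t.2.1]
  -- first homotopy
  have s1 : ∃ u : Circ → ZMod 2, ∀ x, TrivAt (fun a b : Circ => Q (F a - w) (F b - w)) u x := by
    have := contr_triv Q (fun p : Circ × unitInterval => F (((p.2 : ℝ) : ℂ) * p.1) - w) ?_ ?_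
      (F 0 - w) ?_
    · simpa using this
    · refine Continuous.sub (hF.comp_continuous (by fun_prop) fun p => hb _ _ (hI _)) continuous_const
    · intro p
      refine Q_addAt (sub_ne_zero.2 ?_)
      rintro rfl
      exact hwF ⟨_, hb _ _ (hI _), rfl⟩
    · intro x; simp
  have hFc : Continuous fun c : Circ => F c :=
    hF.comp_continuous (by fun_prop) fun c => by simpa using hb c 1 (by simp)
  have s2 : ∃ u : Circ → ZMod 2, ∀ x, TrivAt (fun a b : Circ => Q (F a) (F b)) u x := by
    have := (homotopy_triv_iff Q (fun p : Circ × unitInterval => F p.1 - ((p.2 : ℝ) : ℂ) * w) ?_ ?_).1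
    · simp only [Icc.coe_one, Icc.coe_zero, Complex.ofReal_one, one_mul,
        Complex.ofReal_zero, zero_mul, sub_zero] at this
      exact this s1
    · exact (hFc.comp continuous_fst).sub (by fun_prop)
    · intro p
      refine Q_addAt (sub_ne_zero.2 ?_)
      intro h
      have h1 : ‖F c0‖ ≤ ‖F p.1‖ := hmin p.1.2
      rw [h, norm_mul] at h1
      have := mul_le_mul_of_nonneg_right (hI p.2) (norm_nonneg w)
      linarith
  have hb3 : ∀ t : unitInterval, ‖1 / (1 + ((t : ℝ) : ℂ))‖ ≤ 1 ∧
      ‖- ((t : ℝ) : ℂ) / (1 + ((t : ℝ) : ℂ))‖ ≤ 1 := by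
    intro t
    have e : ‖1 + ((t : ℝ) : ℂ)‖ = 1 + t := by
      have : (1 + ((t : ℝ) : ℂ)) = ((1 + t : ℝ) : ℂ) := by push_cast; rfl
      rw [this, Complex.norm_real, Real.norm_of_nonneg (by linarith [t.2.1])]
    have := t.2.1
    rw [norm_div, norm_div, e, norm_neg, Complex.norm_real, Real.norm_of_nonneg t.2.1, norm_one]
    constructor <;> rw [div_le_one (by linarith)] <;> linarith
  refine odd_nontriv (φ := fun c => F ((1/2) * c) - F (-(1/2) * c)) ?_ ?_ ?_ ?_
  · refine (hF.comp_continuous (by fun_prop) fun c => hb c _ ?_).sub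
      (hF.comp_continuous (by fun_prop) fun c => hb c _ ?_) <;> norm_num
  · intro c
    refine sub_ne_zero.2 fun h => ?_
    have := hi (hb c _ (by norm_num)) (hb c _ (by norm_num)) h
    have h2 : (c : ℂ) = 0 := by linear_combination this
    have := Circ.norm c
    rw [h2] at this; simp at this
  · intro c
    have : ((-c : Circ) : ℂ) = - (c : ℂ) := rfl
    rw [this]; ring_nf
  · have := (homotopy_triv_iff Q (fun p : Circ × unitInterval =>
      F ((1 / (1 + ((p.2 : ℝ) : ℂ))) * p.1) - F ((- ((p.2 : ℝ) : ℂ) / (1 + ((p.2 : ℝ) : ℂ))) * p.1))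
      ?_ ?_).2
    · simp only [Icc.coe_one, Icc.coe_zero, Complex.ofReal_one, one_mul,
        Complex.ofReal_zero, add_zero, div_one, neg_zero, zero_mul, h0, sub_zero] at this
      have h2 : (-1 / (1 + 1) : ℂ) = -(1/2) := by norm_num
      have h3 : (1 / (1 + 1) : ℂ) = (1/2) := by norm_num
      rw [h2, h3] at this
      exact this s2
    · refine (hF.comp_continuous ?_ fun c => hb _ _ (hb3 _).1).sub
        (hF.comp_continuous ?_ fun c => hb _ _ (hb3 _).2)
      · exact (continuous_const.div (by fun_prop) fun p => hden _).mul (by fun_prop)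
      · exact (hcR.neg.div (by fun_prop) fun p => hden _).mul (by fun_prop)
    · intro p
      refine Q_addAt (sub_ne_zero.2 fun h => ?_)
      have := hi (hb _ _ (hb3 _).1) (hb _ _ (hb3 _).2) h
      have hn : (p.1 : ℂ) ≠ 0 := by
        intro h2
        have := Circ.norm p.1
        rw [h2] at this; simp at this
      have h4 := mul_right_cancel₀ hn this
      rw [div_left_inj' (hden _)] at h4
      exact hden p.2 (by linear_combination h4)

end Cradle

namespace Cradle

/-- `E` has non-trivial monodromy around `a`. -/
def Nontriv {X : Type*} [TopologicalSpace X] (E : X → X → ZMod 2) (a : X) : Prop :=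
  ∀ V ∈ 𝓝 a, ∀ u : X → ZMod 2, ¬ ∀ p ∈ V, p ≠ a → TrivAt E u p

lemma noroot {r : ℝ} (hr : 0 < r) : ¬ ∃ ψ : Circ → ℂ, Continuous ψ ∧ ∀ c, ψ c ^ 2 = r * c := by
  classical
  rintro ⟨ψ, hψ, h⟩
  have hr' : (r : ℂ) ≠ 0 := by exact_mod_cast hr.ne'
  have h0 : ∀ c : Circ, (r : ℂ) * c ≠ 0 := by
    intro c hc
    rcases mul_eq_zero.1 hc with h1 | h1
    · exact hr' h1
    · have := Circ.norm c
      rw [h1] at this; simp at this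
  refine odd_nontriv (φ := fun c => (r : ℂ) * c) (by fun_prop) h0 ?_ ⟨_, fun x => sqrt_triv (ψ := ψ) hψ.continuousAt
    (Eventually.of_forall h) (h0 x)⟩
  intro c
  have : ((-c : Circ) : ℂ) = - (c : ℂ) := rfl
  rw [this]; ring

lemma root_far {r : ℝ} {d : ℂ} (hr : 0 < r) (hd : r < ‖d‖) : ∃ χ : Circ → ℂ, Continuous χ ∧
    (∀ c, χ c ^ 2 = r * c + d) ∧ ∀ c, χ c ≠ 0 := by
  have hd0 : d ≠ 0 := by
    rw [← norm_pos_iff]; linarith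
  have hs : ∀ c : Circ, (1 + r * c / d : ℂ) ∈ Complex.slitPlane := by
    intro c
    left
    have h1 : ‖(r * c / d : ℂ)‖ < 1 := by
      rw [norm_div, norm_mul, Circ.norm, Complex.norm_real, Real.norm_of_nonneg hr.le, mul_one,
        div_lt_one (by linarith)]
      exact hd
    have h2 := Complex.abs_re_le_norm (r * c / d : ℂ)
    have h3 := neg_abs_le (r * c / d : ℂ).re
    rw [Complex.add_re, Complex.one_re]
    linarith
  refine ⟨fun c => rt d * rt (1 + r * c / d), ?_, ?_, ?_⟩
  · refine continuous_const.mul (continuous_iff_continuousAt.2 fun c => ?_)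
    exact ContinuousAt.comp (f := fun c : Circ => (1 + r * c / d : ℂ)) (rt_cont (hs c)) (by fun_prop)
  · intro c
    rw [mul_pow, rt_sq, rt_sq]; field_simp
    ring
  · intro c h
    beta_reduce at h
    have h2 : (rt d * rt (1 + r * c / d)) ^ 2 = 0 := by rw [h]; simp
    rw [mul_pow, rt_sq, rt_sq] at h2
    rcases mul_eq_zero.1 h2 with h3 | h3
    · exact hd0 h3
    · exact Complex.slitPlane_ne_zero (hs c) h3

/-- cocycle of a planar arc -/
lemma planar_arc (γ : unitInterval → ℂ) (hγ : Continuous γ) (hi : Function.Injective γ) :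
    ∃ E : ℂ → ℂ → ZMod 2, (∀ p, p ≠ γ 0 → p ≠ γ 1 → AddAt E p) ∧
      (∀ p, p ∉ range γ → TrivAt E (fun _ => 0) p) ∧ Nontriv E (γ 0) ∧ Nontriv E (γ 1) := by
  classical
  set a := γ 0 with ha
  set b := γ 1 with hb
  have hab : a ≠ b := fun h => by
    have := hi h
    exact zero_ne_one this
  set φ : ℂ → ℂ := fun x => (x - a) / (x - b) with hφ
  have hJ : IsClosed (range γ) := (isCompact_range hγ).isClosed
  have hX : IsOpen (range γ)ᶜ := hJ.isOpen_compl
  have t1 : ∃ u : ((range γ)ᶜ : Set ℂ) → ZMod 2, ∀ x,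
      TrivAt (fun p q : ((range γ)ᶜ : Set ℂ) => Q (φ p) (φ q)) u x := by
    have := contr_triv Q (fun p : ((range γ)ᶜ : Set ℂ) × unitInterval =>
      ((p.1 : ℂ) - γ (unitInterval.symm p.2)) / ((p.1 : ℂ) - b)) ?_ ?_ 1 ?_
    · simpa using this
    · refine Continuous.div (by fun_prop) (by fun_prop) fun p => sub_ne_zero.2 ?_
      intro h
      exact p.1.2 ⟨1, h.symm⟩
    · intro p
      refine Q_addAt (div_ne_zero (sub_ne_zero.2 ?_) (sub_ne_zero.2 ?_))
      · intro h
        exact p.1.2 ⟨_, h.symm⟩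
      · intro h
        exact p.1.2 ⟨1, h.symm⟩
    · intro x
      simp only [unitInterval.symm_zero]
      refine div_self (sub_ne_zero.2 ?_)
      intro h
      exact x.2 ⟨1, h.symm⟩
  obtain ⟨s0, hs0⟩ := t1
  set s : ℂ → ZMod 2 := fun x => if h : x ∈ (range γ)ᶜ then s0 ⟨x, h⟩ else 0 with hs
  have hsQ : ∀ p, p ∉ range γ → TrivAt (fun x y => Q (φ x) (φ y)) s p := by
    intro p hp
    exact TrivAt.of_subtype (p := ⟨p, hp⟩) hX (u := s0) (u' := s) (fun x => by
      simp only [hs]; rw [dif_pos x.2]) (hs0 ⟨p, hp⟩)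
  have hδ : ∀ p, TrivAt (fun x y => s x + s y) s p := fun p => ⟨univ, univ_mem, fun _ _ _ _ => rfl⟩
  have hback : ∀ u p, TrivAt (fun x y => Q (φ x) (φ y) + (s x + s y)) u p →
      TrivAt (fun x y => Q (φ x) (φ y)) (fun x => u x + s x) p := by
    intro u p h
    refine (h.add (hδ p)).congrE ⟨univ, univ_mem, fun x _ y _ => ?_⟩
    grind
  refine ⟨fun x y => Q (φ x) (φ y) + (s x + s y), ?_, ?_, ?_, ?_⟩
  · intro p hpa hpb
    refine AddAt.add ?_ (hδ p).addAt
    refine AddAt.comp (f := φ) (Q_addAt (div_ne_zero (sub_ne_zero.2 hpa) (sub_ne_zero.2 hpb))) ?_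
    exact ContinuousAt.div (by fun_prop) (by fun_prop) (sub_ne_zero.2 hpb)
  · intro p hp
    refine ((hsQ p hp).add (hδ p)).congru ?_
    refine Eventually.of_forall fun x => ?_
    grind
  · intro V hV u hu
    obtain ⟨r0, hr0, hrV⟩ := Metric.mem_nhds_iff.1 hV
    have hd : 0 < ‖a - b‖ := norm_pos_iff.2 (sub_ne_zero.2 hab)
    set r := min (r0 / 2) (‖a - b‖ / 2) with hr
    have hrp : 0 < r := by positivity
    have h1 : r < r0 := lt_of_le_of_lt (min_le_left _ _) (by linarith)
    have h2 : r < ‖a - b‖ := lt_of_le_of_lt (min_le_right _ _) (by linarith)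
    obtain ⟨χ, hχ, hχ2, hχ0⟩ := root_far hrp h2
    have hn : ∀ c : Circ, (r * c : ℂ) ≠ 0 := by
      intro c h
      have := congrArg norm h
      rw [norm_mul, Circ.norm, Complex.norm_real, Real.norm_of_nonneg hrp.le] at this
      simp at this; linarith
    have hn' : ∀ c : Circ, (r * c + (a - b) : ℂ) ≠ 0 := by
      intro c h
      rw [← hχ2] at h
      exact hχ0 c (by simpa using h)
    have hφc : ∀ c : Circ, φ (a + r * c) = r * c / (r * c + (a - b)) := by
      intro c
      simp only [hφ]; congr 1 <;> ring
    have hsq := sqrt_of_triv (X := Circ) (φ := fun c => φ (a + r * c))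
      (u := fun c => u (a + r * c) + s (a + r * c)) ?_ ?_ ?_
    · obtain ⟨ψ, hψ, hψ2⟩ := hsq
      refine noroot hrp ⟨fun c => ψ c * χ c, hψ.mul hχ, fun c => ?_⟩
      rw [mul_pow, hψ2, hχ2, hφc]
      have := hn' c
      field_simp
    · simp only [hφc]
      exact Continuous.div (by fun_prop) (by fun_prop) hn'
    · intro c
      rw [hφc]
      exact div_ne_zero (hn c) (hn' c)
    · intro c
      refine TrivAt.comp (f := fun c : Circ => (a + r * c : ℂ)) (hback u _ (hu _ (hrV ?_) ?_)) (by fun_prop)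
      · rw [mem_ball, dist_eq_norm, add_sub_cancel_left, norm_mul, Circ.norm, Complex.norm_real,
          Real.norm_of_nonneg hrp.le]
        linarith
      · intro h
        exact hn c (by simpa using h)
  · intro V hV u hu
    obtain ⟨r0, hr0, hrV⟩ := Metric.mem_nhds_iff.1 hV
    have hd : 0 < ‖b - a‖ := norm_pos_iff.2 (sub_ne_zero.2 hab.symm)
    set r := min (r0 / 2) (‖b - a‖ / 2) with hr
    have hrp : 0 < r := by positivity
    have h1 : r < r0 := lt_of_le_of_lt (min_le_left _ _) (by linarith)
    have h2 : r < ‖b - a‖ := lt_of_le_of_lt (min_le_right _ _) (by linarith)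
    obtain ⟨χ, hχ, hχ2, hχ0⟩ := root_far hrp h2
    have hn : ∀ c : Circ, (r * c : ℂ) ≠ 0 := by
      intro c h
      have := congrArg norm h
      rw [norm_mul, Circ.norm, Complex.norm_real, Real.norm_of_nonneg hrp.le] at this
      simp at this; linarith
    have hn' : ∀ c : Circ, (r * c + (b - a) : ℂ) ≠ 0 := by
      intro c h
      rw [← hχ2] at h
      exact hχ0 c (by simpa using h)
    have hφc : ∀ c : Circ, φ (b + r * c) = (r * c + (b - a)) / (r * c) := by
      intro c
      simp only [hφ]; congr 1 <;> ring
    have hsq := sqrt_of_triv (X := Circ) (φ := fun c => φ (b + r * c))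
      (u := fun c => u (b + r * c) + s (b + r * c)) ?_ ?_ ?_
    · obtain ⟨ψ, hψ, hψ2⟩ := hsq
      have hψ0 : ∀ c, ψ c ≠ 0 := by
        intro c h
        have h3 := hψ2 c
        rw [h, hφc] at h3
        exact div_ne_zero (hn' c) (hn c) (by rw [← h3]; simp)
      refine noroot hrp ⟨fun c => χ c / ψ c, hχ.div hψ hψ0, fun c => ?_⟩
      rw [div_pow, hψ2, hχ2, hφc, div_div_eq_mul_div, mul_div_assoc, mul_comm, div_mul_cancel₀ _ (hn' c)]
    · simp only [hφc]
      exact Continuous.div (by fun_prop) (by fun_prop) hn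
    · intro c
      rw [hφc]
      exact div_ne_zero (hn' c) (hn c)
    · intro c
      refine TrivAt.comp (f := fun c : Circ => (b + r * c : ℂ)) (hback u _ (hu _ (hrV ?_) ?_)) (by fun_prop)
      · rw [mem_ball, dist_eq_norm, add_sub_cancel_left, norm_mul, Circ.norm, Complex.norm_real,
          Real.norm_of_nonneg hrp.le]
        linarith
      · intro h
        exact hn c (by simpa using h)

end Cradle

namespace Cradle

/-- A planar chart. -/
structure Ch (S : Type*) [TopologicalSpace S] where
  /-- the parametrisation -/
  g : ℂ → S
  /-- the coordinate -/
  z : S → ℂ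
  emb : IsOpenEmbedding g
  zg : ∀ w, z (g w) = w

section
variable {S : Type*} [TopologicalSpace S]

lemma Ch.gz (c : Ch S) {y : S} (hy : y ∈ range c.g) : c.g (c.z y) = y := by
  obtain ⟨w, rfl⟩ := hy
  rw [c.zg]

lemma Ch.zcont (c : Ch S) {y : S} (hy : y ∈ range c.g) : ContinuousAt c.z y := by
  obtain ⟨w, rfl⟩ := hy
  rw [← c.emb.continuousAt_iff]
  have : c.z ∘ c.g = id := funext c.zg
  rw [this]; exact continuousAt_id

lemma exists_chart (hS : ∀ x : S, ∃ U : Set S, IsOpen U ∧ x ∈ U ∧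
    Nonempty (U ≃ₜ EuclideanSpace ℝ (Fin 2))) (x : S) : ∃ c : Ch S, c.g 0 = x := by
  obtain ⟨U, hU, hx, ⟨h⟩⟩ := hS x
  let L := Complex.orthonormalBasisOneI.repr.toHomeomorph
  let T : ℂ ≃ₜ U := (L.trans (Homeomorph.addRight (h ⟨x, hx⟩))).trans h.symm
  have hemb : IsOpenEmbedding (fun w => (T w : S)) :=
    hU.isOpenEmbedding_subtypeVal.comp T.isOpenEmbedding
  refine ⟨⟨fun w => (T w : S), Function.invFun (fun w => (T w : S)), hemb,
    Function.leftInverse_invFun hemb.injective⟩, ?_⟩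
  simp [T, L]

/-- local equality of cocycles -/
def LEq (E E' : S → S → ZMod 2) (p : S) : Prop := ∃ V ∈ 𝓝 p, ∀ x ∈ V, ∀ y ∈ V, E' x y = E x y

lemma LEq.symm {E E' : S → S → ZMod 2} {p : S} (h : LEq E E' p) : LEq E' E p := by
  obtain ⟨V, hV, h⟩ := h
  exact ⟨V, hV, fun x hx y hy => (h x hx y hy).symm⟩

lemma AddAt.congrE {E E' : S → S → ZMod 2} {p : S} (h : AddAt E p) (h' : LEq E E' p) :
    AddAt E' p := (h.trivAt.congrE h').addAt

lemma Nontriv.congrE {E E' : S → S → ZMod 2} {a : S} {W : Set S} (hW : W ∈ 𝓝 a) (h : Nontriv E a)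
    (h' : ∀ p ∈ W, p ≠ a → LEq E E' p) : Nontriv E' a := by
  intro V hV u hu
  exact h (V ∩ W) (inter_mem hV hW) u fun p hp hpa => (hu p hp.1 hpa).congrE (h' p hp.2 hpa).symm

/-- adding a locally trivial cocycle -/
lemma Nontriv.add_triv {E E' : S → S → ZMod 2} {a : S} {v : S → ZMod 2} {W : Set S} (hW : W ∈ 𝓝 a)
    (h : Nontriv E a) (h' : ∀ p ∈ W, p ≠ a → TrivAt E' v p) :
    Nontriv (fun x y => E x y + E' x y) a := by
  intro V hV u hu
  refine h (V ∩ W) (inter_mem hV hW) (fun x => u x + v x) fun p hp hpa => ?_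
  refine ((hu p hp.1 hpa).add (h' p hp.2 hpa)).congrE ⟨univ, univ_mem, fun x _ y _ => ?_⟩
  grind

lemma patch [RegularSpace S] [T1Space S] {F : S → S → ZMod 2} {p : S} {V : Set S} (hV : V ∈ 𝓝 p)
    {u : S → ZMod 2} (hu : ∀ q ∈ V, q ≠ p → TrivAt F u q) :
    ∃ F' : S → S → ZMod 2, (∀ q, q ≠ p → LEq F F' q) ∧ TrivAt F' u p := by
  classical
  obtain ⟨V', hV', hcl, hVV⟩ := exists_mem_nhds_isClosed_subset hV
  refine ⟨fun x y => if x ∈ V' ∧ y ∈ V' then u x + u y else F x y, ?_, ?_⟩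
  · intro q hq
    by_cases hqV : q ∈ V'
    · obtain ⟨N, hN, h⟩ := hu q (hVV hqV) hq
      refine ⟨N, hN, fun x hx y hy => ?_⟩
      beta_reduce
      split_ifs
      · rw [h x hx y hy]
      · rfl
    · refine ⟨V'ᶜ, hcl.isOpen_compl.mem_nhds hqV, fun x hx y hy => ?_⟩
      beta_reduce
      rw [if_neg (fun h => hx h.1)]
  · exact ⟨V', hV', fun x hx y hy => by beta_reduce; rw [if_pos ⟨hx, hy⟩]⟩

end

/-- Data of a cocycle on a punctured disc. -/
def PData (r : ℝ) (E : ℂ → ℂ → ZMod 2) (u₁ u₂ : ℂ → ZMod 2) (k l : ZMod 2) : Prop :=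
  (∀ p ∈ ball (0 : ℂ) r, p ∈ Complex.slitPlane → TrivAt E u₁ p) ∧
  (∀ p ∈ ball (0 : ℂ) r, -p ∈ Complex.slitPlane → TrivAt E u₂ p) ∧
  (∀ p ∈ ball (0 : ℂ) r, 0 < p.im → u₁ p + u₂ p = k) ∧
  (∀ p ∈ ball (0 : ℂ) r, p.im < 0 → u₁ p + u₂ p = l)

lemma star_triv' {K : Set ℂ} {c : ℂ} (hc : c ∈ K) (hK : StarConvex ℝ c K) (hKo : IsOpen K)
    (E : ℂ → ℂ → ZMod 2) (hE : ∀ p ∈ K, AddAt E p) : ∃ u : ℂ → ZMod 2, ∀ p ∈ K, TrivAt E u p := by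
  classical
  obtain ⟨u, hu⟩ := star_triv hc hK (fun a b : K => E a b) (fun p => (hE p p.2).comp (f := Subtype.val)
    continuous_subtype_val.continuousAt)
  refine ⟨fun x => if h : x ∈ K then u ⟨x, h⟩ else 0, fun p hp => ?_⟩
  exact TrivAt.of_subtype (p := ⟨p, hp⟩) hKo (fun x => by rw [dif_pos x.2]) (hu ⟨p, hp⟩)

lemma exists_pdata {r : ℝ} (hr : 0 < r) {E : ℂ → ℂ → ZMod 2}
    (hE : ∀ p ∈ ball (0 : ℂ) r, p ≠ 0 → AddAt E p) : ∃ u₁ u₂ k l, PData r E u₁ u₂ k l := by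
  have hr2 : ((r / 2 : ℝ) : ℂ) ∈ ball (0 : ℂ) r := by
    rw [mem_ball_zero_iff, Complex.norm_real, Real.norm_of_nonneg (by linarith)]; linarith
  have hs : ((r / 2 : ℝ) : ℂ) ∈ Complex.slitPlane := by
    left; rw [Complex.ofReal_re]; linarith
  have st : StarConvex ℝ ((r / 2 : ℝ) : ℂ) (ball (0 : ℂ) r ∩ Complex.slitPlane) :=
    ((convex_ball (0 : ℂ) r).starConvex hr2).inter
      (Complex.starConvex_ofReal_slitPlane (by linarith))
  have ho : IsOpen (ball (0 : ℂ) r ∩ Complex.slitPlane) := isOpen_ball.inter Complex.isOpen_slitPlane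
  obtain ⟨u₁, h₁⟩ := star_triv' (K := ball (0 : ℂ) r ∩ Complex.slitPlane) ⟨hr2, hs⟩ st ho E
    (fun p hp => hE p hp.1 (Complex.slitPlane_ne_zero hp.2))
  obtain ⟨u₂, h₂⟩ := star_triv' (K := -(ball (0 : ℂ) r ∩ Complex.slitPlane)) (c := -((r / 2 : ℝ) : ℂ))
    (by rw [Set.mem_neg, neg_neg]; exact ⟨hr2, hs⟩) st.neg ho.neg E (fun p hp => hE p (by simpa using hp.1) (by
      have := Complex.slitPlane_ne_zero hp.2
      simpa using this))
  have h₂' : ∀ p ∈ ball (0 : ℂ) r, -p ∈ Complex.slitPlane → TrivAt E u₂ p := fun p hp hp' =>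
    h₂ p ⟨by simpa using hp, hp'⟩
  have hlc : ∀ p ∈ ball (0 : ℂ) r, p.im ≠ 0 → LC (fun x => u₁ x + u₂ x) p := fun p hp hi =>
    (h₁ p ⟨hp, Or.inr hi⟩).lc (h₂' p hp (Or.inr (by simpa using hi)))
  have hI : ∀ s : ℝ, |s| = 1 → ((s * (r / 2) : ℝ) : ℂ) * Complex.I ∈ ball (0 : ℂ) r := by
    intro s hs
    rw [mem_ball_zero_iff, norm_mul, Complex.norm_I, Complex.norm_real, mul_one, Real.norm_eq_abs,
      abs_mul, hs, abs_of_pos (by linarith)]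
    linarith
  refine ⟨u₁, u₂, u₁ (((1 * (r / 2) : ℝ) : ℂ) * Complex.I) + u₂ (((1 * (r / 2) : ℝ) : ℂ) * Complex.I),
    u₁ ((((-1) * (r / 2) : ℝ) : ℂ) * Complex.I) + u₂ ((((-1) * (r / 2) : ℝ) : ℂ) * Complex.I),
    fun p hp hp' => h₁ p ⟨hp, hp'⟩, h₂', ?_, ?_⟩
  · intro p hp hpi
    refine LC.const_on (h := fun x => u₁ x + u₂ x) (T := ball (0 : ℂ) r ∩ {p | 0 < p.im}) ?_ ?_
      ⟨hp, hpi⟩ ⟨hI 1 (by simp), ?_⟩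
    · exact ((convex_ball _ _).inter (convex_halfSpace_im_gt 0)).isPreconnected
    · exact fun q hq => hlc q hq.1 (ne_of_gt hq.2)
    · simp [hr]
  · intro p hp hpi
    refine LC.const_on (h := fun x => u₁ x + u₂ x) (T := ball (0 : ℂ) r ∩ {p | p.im < 0}) ?_ ?_
      ⟨hp, hpi⟩ ⟨hI (-1) (by simp), ?_⟩
    · exact ((convex_ball _ _).inter (convex_halfSpace_im_lt 0)).isPreconnected
    · exact fun q hq => hlc q hq.1 (ne_of_lt hq.2)
    · simp [hr]

lemma PData.add {r : ℝ} {E E' : ℂ → ℂ → ZMod 2} {u₁ u₂ u₁' u₂' : ℂ → ZMod 2} {k l k' l' : ZMod 2}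
    (h : PData r E u₁ u₂ k l) (h' : PData r E' u₁' u₂' k' l') :
    PData r (fun x y => E x y + E' x y) (fun x => u₁ x + u₁' x) (fun x => u₂ x + u₂' x)
      (k + k') (l + l') := by
  obtain ⟨a, b, c, d⟩ := h
  obtain ⟨a', b', c', d'⟩ := h'
  refine ⟨fun p h h' => (a p h h').add (a' p h h'), fun p h h' => (b p h h').add (b' p h h'),
    fun p h h' => ?_, fun p h h' => ?_⟩
  · have := c p h h'
    have := c' p h h'
    grind
  · have := d p h h'
    have := d' p h h'
    grind

lemma PData.glue {r : ℝ} {E : ℂ → ℂ → ZMod 2} {u₁ u₂ : ℂ → ZMod 2} {k : ZMod 2}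
    (h : PData r E u₁ u₂ k k) :
    ∃ u : ℂ → ZMod 2, ∀ p ∈ ball (0 : ℂ) r, p ≠ 0 → TrivAt E u p := by
  classical
  obtain ⟨a, b, c, d⟩ := h
  refine ⟨fun x => if x ∈ Complex.slitPlane then u₁ x else u₂ x + k, fun p hp hp0 => ?_⟩
  by_cases hps : p ∈ Complex.slitPlane
  · refine (a p hp hps).congru ?_
    unfold LC
    filter_upwards [Complex.isOpen_slitPlane.mem_nhds hps] with x hx
    rw [if_pos hx, if_pos hps]; grind
  · have hns : -p ∈ Complex.slitPlane := by
      rcases Complex.mem_slitPlane_or_neg_mem_slitPlane hp0 with h | h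
      · exact absurd h hps
      · exact h
    refine (b p hp hns).congru ?_
    unfold LC
    filter_upwards [Complex.isOpen_slitPlane.neg.mem_nhds hns, isOpen_ball.mem_nhds hp] with x hx hxb
    rw [if_neg hps]
    split_ifs with hxs
    · have him : x.im ≠ 0 := by
        intro h
        rcases hxs with h1 | h1
        · rcases hx with h2 | h2
          · simp at h2; linarith
          · simp at h2; exact h2 h
        · exact h1 h
      rcases lt_or_gt_of_ne him with h1 | h1
      · have := d x hxb h1
        grind
      · have := c x hxb h1
        grind
    · grind

lemma planarP {r : ℝ} (hr : 0 < r) {E E' : ℂ → ℂ → ZMod 2}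
    (hE : ∀ p ∈ ball (0 : ℂ) r, p ≠ 0 → AddAt E p) (hE' : ∀ p ∈ ball (0 : ℂ) r, p ≠ 0 → AddAt E' p)
    (hn : ¬ ∃ u : ℂ → ZMod 2, ∀ p ∈ ball (0 : ℂ) r, p ≠ 0 → TrivAt E u p)
    (hn' : ¬ ∃ u : ℂ → ZMod 2, ∀ p ∈ ball (0 : ℂ) r, p ≠ 0 → TrivAt E' u p) :
    ∃ u : ℂ → ZMod 2, ∀ p ∈ ball (0 : ℂ) r, p ≠ 0 → TrivAt (fun x y => E x y + E' x y) u p := by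
  obtain ⟨u₁, u₂, k, l, h⟩ := exists_pdata hr hE
  obtain ⟨u₁', u₂', k', l', h'⟩ := exists_pdata hr hE'
  have hkl : k ≠ l := by rintro rfl; exact hn h.glue
  have hkl' : k' ≠ l' := by rintro rfl; exact hn' h'.glue
  have e : k + k' = l + l' := by
    have : ∀ k l k' l' : ZMod 2, k ≠ l → k' ≠ l' → k + k' = l + l' := by decide
    exact this _ _ _ _ hkl hkl'
  have h2 := h.add h'
  rw [e] at h2
  exact h2.glue

lemma surfP {S : Type*} [TopologicalSpace S] (c : Ch S) {p : S} (hc : c.g 0 = p)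
    {E E' : S → S → ZMod 2} {V : Set S} (hV : V ∈ 𝓝 p)
    (hE : ∀ q ∈ V, q ≠ p → AddAt E q) (hE' : ∀ q ∈ V, q ≠ p → AddAt E' q)
    (hn : Nontriv E p) (hn' : Nontriv E' p) :
    ∃ W ∈ 𝓝 p, ∃ u : S → ZMod 2, ∀ q ∈ W, q ≠ p → TrivAt (fun x y => E x y + E' x y) u q := by
  subst hc
  have hpre : c.g ⁻¹' V ∈ 𝓝 (0 : ℂ) := c.emb.continuous.continuousAt hV
  obtain ⟨r, hr, hrV⟩ := Metric.mem_nhds_iff.1 hpre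
  have hW : c.g '' ball 0 r ∈ 𝓝 (c.g 0) := c.emb.image_mem_nhds.2 (ball_mem_nhds _ hr)
  -- transfer
  have down : ∀ F : S → S → ZMod 2, (∀ q ∈ V, q ≠ c.g 0 → AddAt F q) →
      ∀ w ∈ ball (0 : ℂ) r, w ≠ 0 → AddAt (fun x y => F (c.g x) (c.g y)) w := by
    intro F hF w hw hw0
    exact (hF _ (hrV hw) (fun h => hw0 (c.emb.injective h))).comp c.emb.continuous.continuousAt
  have up : ∀ (F : S → S → ZMod 2) (u : ℂ → ZMod 2),
      (∀ w ∈ ball (0 : ℂ) r, w ≠ 0 → TrivAt (fun x y => F (c.g x) (c.g y)) u w) →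
      ∀ q ∈ c.g '' ball 0 r, q ≠ c.g 0 → TrivAt F (fun x => u (c.z x)) q := by
    rintro F u hu _ ⟨w, hw, rfl⟩ hne
    have h1 := hu w hw (fun h => hne (by rw [h]))
    have h2 : TrivAt (fun x y => F (c.g x) (c.g y)) u (c.z (c.g w)) := by rwa [c.zg]
    refine (h2.comp (c.zcont ⟨w, rfl⟩)).congrE ⟨range c.g, c.emb.isOpen_range.mem_nhds ⟨w, rfl⟩, ?_⟩
    intro x hx y hy
    rw [c.gz hx, c.gz hy]
  obtain ⟨u, hu⟩ := planarP hr (down E hE) (down E' hE')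
    (fun ⟨u, hu⟩ => hn _ hW _ (up E u hu)) (fun ⟨u, hu⟩ => hn' _ hW _ (up E' u hu))
  exact ⟨_, hW, _, up (fun x y => E x y + E' x y) u hu⟩

end Cradle

namespace Cradle

section
variable {S : Type*} [TopologicalSpace S]

/-- `E` is a cocycle dual to the arc `f '' [s,t]`. -/
def ArcCo (f : ℝ → S) (s t : ℝ) (E : S → S → ZMod 2) : Prop :=
  (∀ p, p ≠ f s → p ≠ f t → AddAt E p) ∧ (∀ p, p ∉ f '' Icc s t → TrivAt E (fun _ => 0) p) ∧
    Nontriv E (f s) ∧ Nontriv E (f t)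

lemma small_arc [T2Space S] [CompactSpace S] (c : Ch S) (f : unitInterval → S) (hf : Continuous f)
    (hi : Function.Injective f) (hc : range f ⊆ range c.g) :
    ∃ E : S → S → ZMod 2, (∀ p, p ≠ f 0 → p ≠ f 1 → AddAt E p) ∧
      (∀ p, p ∉ range f → TrivAt E (fun _ => 0) p) ∧ Nontriv E (f 0) ∧ Nontriv E (f 1) := by
  classical
  obtain ⟨E, h1, h2, h3, h4⟩ := planar_arc (fun t => c.z (f t))
    (continuous_iff_continuousAt.2 fun t =>
      ContinuousAt.comp (g := c.z) (c.zcont (hc ⟨t, rfl⟩)) hf.continuousAt)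
    (by
      intro a b hab
      apply hi
      rw [← c.gz (hc ⟨a, rfl⟩), ← c.gz (hc ⟨b, rfl⟩)]
      exact congrArg c.g hab)
  obtain ⟨U, hU, hJU, hcl, -⟩ := exists_open_between_and_isCompact_closure (isCompact_range hf)
    c.emb.isOpen_range hc
  have hUr : U ⊆ range c.g := subset_closure.trans hcl
  set F : S → S → ZMod 2 := fun x y => if x ∈ U ∧ y ∈ U then E (c.z x) (c.z y) else 0 with hF
  have hloc : ∀ p ∈ U, LEq (fun x y => E (c.z x) (c.z y)) F p := fun p hp =>
    ⟨U, hU.mem_nhds hp, fun x hx y hy => by simp only [hF]; rw [if_pos ⟨hx, hy⟩]⟩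
  have hz : ∀ p, p ∉ range f → TrivAt F (fun _ => 0) p := by
    intro p hp
    by_cases hpr : p ∈ range c.g
    · have h5 : TrivAt E (fun _ => 0) (c.z p) := by
        refine h2 _ ?_
        rintro ⟨t, ht⟩
        apply hp
        refine ⟨t, ?_⟩
        rw [← c.gz hpr, ← ht]
        exact (c.gz (hc ⟨t, rfl⟩)).symm
      obtain ⟨N, hN, h6⟩ := h5.comp (c.zcont hpr)
      refine ⟨N, hN, fun x hx y hy => ?_⟩
      simp only [hF]
      split_ifs
      · exact h6 x hx y hy
      · rfl
    · refine ⟨(closure U)ᶜ, isClosed_closure.isOpen_compl.mem_nhds fun h => hpr (hcl h), ?_⟩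
      intro x hx y hy
      simp only [hF]
      rw [if_neg fun h => hx (subset_closure h.1)]; rfl
  have hnt : ∀ t, Nontriv E (c.z (f t)) → Nontriv F (f t) := by
    intro t hn V hV u hu
    have hVU : c.g ⁻¹' (V ∩ U) ∈ 𝓝 (c.z (f t)) := by
      apply c.emb.continuous.continuousAt
      rw [c.gz (hc ⟨t, rfl⟩)]
      exact inter_mem hV (hU.mem_nhds (hJU ⟨t, rfl⟩))
    refine hn _ hVU (fun w => u (c.g w)) fun w hw hne => ?_
    have h5 := hu (c.g w) hw.1 (fun h => hne (by rw [← h, c.zg]))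
    have h6 := (h5.congrE (hloc _ hw.2).symm).comp (c.emb.continuous.continuousAt)
    refine h6.congrE ⟨univ, univ_mem, fun x _ y _ => ?_⟩
    rw [c.zg, c.zg]
  refine ⟨F, ?_, hz, hnt 0 h3, hnt 1 h4⟩
  intro p hp0 hp1
  by_cases hp : p ∈ range f
  · refine AddAt.congrE (AddAt.comp (f := c.z) (h1 _ ?_ ?_) (c.zcont (hc hp))) (hloc p (hJU hp))
    · intro h
      apply hp0
      rw [← c.gz (hc hp), h, c.gz (hc ⟨0, rfl⟩)]
    · intro h
      apply hp1
      rw [← c.gz (hc hp), h, c.gz (hc ⟨1, rfl⟩)]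
  · exact (hz p hp).addAt

lemma small_arc' [T2Space S] [CompactSpace S] (c : Ch S) {f : ℝ → S} (hf : Continuous f)
    {s t : ℝ} (hst : s < t) (hi : InjOn f (Icc s t)) (hc : f '' Icc s t ⊆ range c.g) :
    ∃ E, ArcCo f s t E := by
  set h : unitInterval → ℝ := fun τ => s + τ * (t - s) with hh
  have hm : ∀ τ, h τ ∈ Icc s t := by
    intro τ
    have h1 := τ.2.1
    have h2 := τ.2.2
    constructor <;> simp only [hh] <;> nlinarith
  have hr : range (fun τ => f (h τ)) = f '' Icc s t := by
    ext p
    constructor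
    · rintro ⟨τ, rfl⟩
      exact ⟨_, hm τ, rfl⟩
    · rintro ⟨x, hx, rfl⟩
      have hpos : 0 < t - s := by linarith
      refine ⟨⟨(x - s) / (t - s), div_nonneg (by linarith [hx.1]) hpos.le,
        (div_le_one hpos).2 (by linarith [hx.2])⟩, ?_⟩
      simp only [hh]
      congr 1
      field_simp
      ring
  have h0 : h 0 = s := by simp [hh]
  have h1 : h 1 = t := by simp [hh]
  obtain ⟨E, a, b, d, e⟩ := small_arc c (fun τ => f (h τ)) (hf.comp (by fun_prop)) (by
    intro x y hxy
    have := hi (hm x) (hm y) hxy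
    simp only [hh] at this
    have h3 : (x : ℝ) = y := by
      have : ((x : ℝ) - y) * (t - s) = 0 := by linear_combination this
      rcases mul_eq_zero.1 this with h | h <;> linarith
    exact Subtype.ext h3) (hr ▸ hc)
  rw [hr] at b
  simp only [h0, h1] at a d e
  exact ⟨E, a, b, d, e⟩

lemma ArcCo.concat [T2Space S] [CompactSpace S] (hch : ∀ x : S, ∃ c : Ch S, c.g 0 = x)
    {f : ℝ → S} (hf : Continuous f) {s t w : ℝ} (hst : s < t) (htw : t < w)
    (hi : InjOn f (Icc s w)) {E E' : S → S → ZMod 2} (h : ArcCo f s t E) (h' : ArcCo f t w E') :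
    ∃ F, ArcCo f s w F := by
  obtain ⟨c, hc⟩ := hch (f t)
  obtain ⟨a1, a2, a3, a4⟩ := h
  obtain ⟨b1, b2, b3, b4⟩ := h'
  have is : s ∈ Icc s w := ⟨le_rfl, by linarith⟩
  have it : t ∈ Icc s w := ⟨by linarith, by linarith⟩
  have iw : w ∈ Icc s w := ⟨by linarith, le_rfl⟩
  have nts : f t ≠ f s := fun h => by have := hi it is h; linarith
  have ntw : f t ≠ f w := fun h => by have := hi it iw h; linarith
  have hV : ({f s, f w}ᶜ : Set S) ∈ 𝓝 (f t) := by
    refine (Set.Finite.isClosed (by simp)).isOpen_compl.mem_nhds ?_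
    simp [nts, ntw]
  obtain ⟨W, hW, u, hu⟩ := surfP c hc hV
    (E := E) (E' := E') (fun q hq hqt => a1 q (fun h => hq (by simp [h])) hqt)
    (fun q hq hqt => b1 q hqt (fun h => hq (by simp [h]))) a4 b3
  obtain ⟨F, hF, hFt⟩ := patch hW hu
  have U1 : f '' Icc s t ⊆ f '' Icc s w := image_mono (Icc_subset_Icc le_rfl htw.le)
  have U2 : f '' Icc t w ⊆ f '' Icc s w := image_mono (Icc_subset_Icc hst.le le_rfl)
  have c1 : IsClosed (f '' Icc s t) := (isCompact_Icc.image hf).isClosed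
  have c2 : IsClosed (f '' Icc t w) := (isCompact_Icc.image hf).isClosed
  have s2 : f s ∉ f '' Icc t w := by
    rintro ⟨x, hx, hxs⟩
    have := hi ⟨by linarith [hx.1], hx.2⟩ is hxs
    linarith [hx.1]
  have w1 : f w ∉ f '' Icc s t := by
    rintro ⟨x, hx, hxs⟩
    have := hi ⟨hx.1, by linarith [hx.2]⟩ iw hxs
    linarith [hx.2]
  have hne : ∀ q, q ≠ f t → {x | x ≠ f t} ∈ 𝓝 q := fun q hq => isOpen_ne.mem_nhds hq
  refine ⟨F, ?_, ?_, ?_, ?_⟩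
  · intro p hps hpw
    by_cases hpt : p = f t
    · subst hpt
      exact hFt.addAt
    · exact AddAt.congrE ((a1 p hps hpt).add (b1 p hpt hpw)) (hF p hpt)
  · intro p hp
    have hpt : p ≠ f t := fun h => hp (h ▸ ⟨t, it, rfl⟩)
    have := ((a2 p fun h => hp (U1 h)).add (b2 p fun h => hp (U2 h))).congrE (hF p hpt)
    simpa using this
  · refine Nontriv.congrE (hne _ nts.symm) (Nontriv.add_triv (v := fun _ => 0)
      (c2.isOpen_compl.mem_nhds s2) a3 ?_) (fun p hp _ => hF p hp)
    exact fun p hp _ => b2 p hp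
  · refine Nontriv.congrE (E := fun x y => E' x y + E x y) (hne _ ntw.symm) (Nontriv.add_triv (v := fun _ => 0)
      (c1.isOpen_compl.mem_nhds w1) b4 ?_) (fun p hp _ => ?_)
    · exact fun p hp _ => a2 p hp
    · obtain ⟨V, hV, h⟩ := hF p hp
      exact ⟨V, hV, fun x hx y hy => (h x hx y hy).trans (add_comm _ _)⟩

lemma arc_cocycle [T2Space S] [CompactSpace S] (hch : ∀ x : S, ∃ c : Ch S, c.g 0 = x)
    {f : ℝ → S} (hf : Continuous f) (hi : InjOn f (Icc 0 1)) : ∃ E, ArcCo f 0 1 E := by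
  choose c hc using hch
  obtain ⟨δ, hδ, hL⟩ := lebesgue_number_lemma_of_metric (s := Icc (0 : ℝ) 1)
    (c := fun x : S => f ⁻¹' range (c x).g) isCompact_Icc
    (fun x => (c x).emb.isOpen_range.preimage hf)
    (fun t _ => mem_iUnion.2 ⟨f t, ⟨0, hc _⟩⟩)
  obtain ⟨N, hN⟩ := exists_nat_one_div_lt hδ
  have hNp : (0 : ℝ) < N + 1 := by positivity
  have step : ∀ k : ℕ, k < N + 1 → ∃ E, ArcCo f (k / (N + 1)) ((k + 1) / (N + 1)) E := by
    intro k hk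
    have hk' : (k : ℝ) + 1 ≤ N + 1 := by exact_mod_cast hk
    have h0 : (0 : ℝ) ≤ k / (N + 1) := by positivity
    have h1 : ((k : ℝ) + 1) / (N + 1) ≤ 1 := (div_le_one hNp).2 hk'
    have hd : ((k : ℝ) + 1) / (N + 1) = k / (N + 1) + 1 / (N + 1) := by ring
    have hpos : (0 : ℝ) < 1 / (N + 1) := by positivity
    obtain ⟨x, hx⟩ := hL (k / (N + 1)) ⟨h0, by linarith⟩
    refine small_arc' (c x) hf (by linarith) (hi.mono (Icc_subset_Icc h0 h1)) ?_
    rintro _ ⟨τ, hτ, rfl⟩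
    apply hx
    rw [mem_ball, Real.dist_eq, abs_of_nonneg (by linarith [hτ.1])]
    linarith [hτ.2]
  have key : ∀ k : ℕ, k < N + 1 → ∃ E, ArcCo f 0 ((k + 1) / (N + 1)) E := by
    intro k
    induction k with
    | zero =>
      intro hk
      simpa using step 0 hk
    | succ k ih =>
      intro hk
      obtain ⟨E, hE⟩ := ih (by omega)
      obtain ⟨E', hE'⟩ := step (k + 1) hk
      push_cast at hE' ⊢
      have hk' : (k : ℝ) + 1 + 1 ≤ N + 1 := by exact_mod_cast hk
      refine hE.concat (fun x => ⟨c x, hc x⟩) hf (by positivity) ?_ (hi.mono (Icc_subset_Icc le_rfl ?_)) hE'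
      · rw [div_lt_div_iff_of_pos_right hNp]; linarith
      · exact (div_le_one hNp).2 hk'
  obtain ⟨E, hE⟩ := key N (by omega)
  rw [div_self hNp.ne'] at hE
  exact ⟨E, hE⟩

end

end Cradle

namespace Cradle

section
variable {S : Type*} [TopologicalSpace S]

/-- cocycles are trivial on charts -/
lemma Ch.triv (c : Ch S) {E : S → S → ZMod 2} (hE : ∀ p ∈ range c.g, AddAt E p) :
    ∃ u : S → ZMod 2, ∀ p ∈ range c.g, TrivAt E u p := by
  obtain ⟨u, hu⟩ := star_triv' (K := univ) (c := 0) (mem_univ _) (starConvex_univ _) isOpen_univ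
    (fun x y => E (c.g x) (c.g y))
    (fun w _ => (hE _ ⟨w, rfl⟩).comp c.emb.continuous.continuousAt)
  refine ⟨fun x => u (c.z x), fun p hp => ?_⟩
  refine ((hu (c.z p) (mem_univ _)).comp (c.zcont hp)).congrE
    ⟨range c.g, c.emb.isOpen_range.mem_nhds hp, ?_⟩
  intro x hx y hy
  rw [c.gz hx, c.gz hy]

lemma conn_nhd (c : Ch S) {p : S} (hc : c.g 0 = p) {V : Set S} (hV : V ∈ 𝓝 p) :
    ∃ O, IsOpen O ∧ p ∈ O ∧ O ⊆ V ∧ IsPreconnected O := by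
  subst hc
  obtain ⟨r, hr, hrV⟩ := Metric.mem_nhds_iff.1 (c.emb.continuous.continuousAt hV)
  refine ⟨c.g '' ball 0 r, c.emb.isOpenMap _ isOpen_ball, ⟨0, by simpa using hr, rfl⟩,
    image_subset_iff.2 hrV, (convex_ball _ _).isPreconnected.image _ c.emb.continuous.continuousOn⟩

lemma finiteness [T2Space S] [CompactSpace S] (hch : ∀ x : S, ∃ c : Ch S, c.g 0 = x)
    (β : ℕ → S → S → ZMod 2) (hβ : ∀ n p, AddAt (β n) p) :
    ∃ I : Set ℕ, I.Infinite ∧ ∀ n ∈ I, ∀ m ∈ I, ∃ w : S → ZMod 2, ∀ p,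
      TrivAt (fun x y => β n x y + β m x y) w p := by
  classical
  choose c hc using hch
  have hh : ∀ n x, ∃ u : S → ZMod 2, ∀ p ∈ range (c x).g, TrivAt (β n) u p :=
    fun n x => (c x).triv fun p _ => hβ n p
  choose h hh using hh
  set K : S → Set S := fun x => (c x).g '' closedBall 0 1 with hK
  set B : S → Set S := fun x => (c x).g '' ball 0 1 with hB
  have hBo : ∀ x, IsOpen (B x) := fun x => (c x).emb.isOpenMap _ isOpen_ball
  have hxB : ∀ x, x ∈ B x := fun x => ⟨0, by simp, hc x⟩
  have hBK : ∀ x, B x ⊆ K x := fun x => image_mono ball_subset_closedBall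
  have hKr : ∀ x, K x ⊆ range (c x).g := fun x => image_subset_range _ _
  have hKc : ∀ x, IsCompact (K x) := fun x =>
    (isCompact_closedBall _ _).image (c x).emb.continuous
  obtain ⟨T, -, hT⟩ := isCompact_univ.elim_nhds_subcover B fun x _ => (hBo x).mem_nhds (hxB x)
  have hP : ∀ x y, ∃ P : Finset S, ∀ q ∈ K x ∩ K y, ∃ p ∈ P, ∀ n,
      h n x p + h n y p = h n x q + h n y q := by
    intro x y
    have hO : ∀ p, ∃ O, IsOpen O ∧ p ∈ O ∧ (p ∈ K x ∩ K y → O ⊆ range (c x).g ∩ range (c y).g) ∧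
        IsPreconnected O := by
      intro p
      by_cases hp : p ∈ K x ∩ K y
      · obtain ⟨O, h1, h2, h3, h4⟩ := conn_nhd (c p) (hc p) (V := range (c x).g ∩ range (c y).g)
          (((c x).emb.isOpen_range.inter (c y).emb.isOpen_range).mem_nhds ⟨hKr x hp.1, hKr y hp.2⟩)
        exact ⟨O, h1, h2, fun _ => h3, h4⟩
      · obtain ⟨O, h1, h2, h3, h4⟩ := conn_nhd (c p) (hc p) (V := univ) univ_mem
        exact ⟨O, h1, h2, fun h => absurd h hp, h4⟩
    choose O hO1 hO2 hO3 hO4 using hO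
    obtain ⟨P, hP, hcov⟩ := ((hKc x).inter (hKc y)).elim_nhds_subcover O fun p _ =>
      (hO1 p).mem_nhds (hO2 p)
    refine ⟨P, fun q hq => ?_⟩
    obtain ⟨p, hp, hqO⟩ := mem_iUnion₂.1 (hcov hq)
    refine ⟨p, hp, fun n => ?_⟩
    refine LC.const_on (h := fun q => h n x q + h n y q) (hO4 p) (fun r hr => ?_) (hO2 p) hqO
    have := hO3 p (hP p hp) hr
    exact (hh n x r this.1).lc (hh n y r this.2)
  choose P hP using hP
  let code : ℕ → (∀ x : T, ∀ y : T, P x y → ZMod 2) := fun n x y p => h n x p + h n y p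
  obtain ⟨k, hk⟩ := Finite.exists_infinite_fiber code
  refine ⟨code ⁻¹' {k}, infinite_coe_iff.1 hk, fun n hn m hm => ?_⟩
  have hnm : code n = code m := by
    rw [mem_preimage, mem_singleton_iff] at hn hm
    rw [hn, hm]
  have hsel : ∀ q : S, ∃ x ∈ T, q ∈ B x := fun q => by
    obtain ⟨x, hx, hq⟩ := mem_iUnion₂.1 (hT (mem_univ q))
    exact ⟨x, hx, hq⟩
  choose s hsT hsB using hsel
  refine ⟨fun q => h n (s q) q + h m (s q) q, fun p => ?_⟩
  refine ((hh n (s p) p (hKr _ (hBK _ (hsB p)))).add (hh m (s p) p (hKr _ (hBK _ (hsB p))))).congru ?_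
  have hz : ∀ q ∈ B (s p), (h n (s p) q + h m (s p) q) + (h n (s q) q + h m (s q) q) = 0 := by
    intro q hq
    obtain ⟨r, hr, h1⟩ := hP (s p) (s q) q ⟨hBK _ hq, hBK _ (hsB q)⟩
    have h2 := congrFun (congrFun (congrFun hnm ⟨s p, hsT p⟩) ⟨s q, hsT q⟩) ⟨r, hr⟩
    have h3 := h1 n
    have h4 := h1 m
    simp only [code] at h2
    grind
  unfold LC
  filter_upwards [(hBo (s p)).mem_nhds (hsB p)] with q hq
  rw [hz q hq, hz p (hsB p)]

lemma beta [T2Space S] [CompactSpace S] (hch : ∀ x : S, ∃ c : Ch S, c.g 0 = x) {d d' : S}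
    (hd : d ≠ d') {E E' : S → S → ZMod 2} (hE : ∀ p, p ≠ d → p ≠ d' → AddAt E p)
    (hE' : ∀ p, p ≠ d → p ≠ d' → AddAt E' p) (h1 : Nontriv E d) (h1' : Nontriv E' d)
    (h2 : Nontriv E d') (h2' : Nontriv E' d') :
    ∃ β : S → S → ZMod 2, (∀ p, AddAt β p) ∧ ∀ p, p ≠ d → p ≠ d' →
      LEq (fun x y => E x y + E' x y) β p := by
  have hV : ({x | x ≠ d'} : Set S) ∈ 𝓝 d := isOpen_ne.mem_nhds hd
  have hV' : ({x | x ≠ d} : Set S) ∈ 𝓝 d' := isOpen_ne.mem_nhds hd.symm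
  obtain ⟨c, hc⟩ := hch d
  obtain ⟨c', hc'⟩ := hch d'
  obtain ⟨W, hW, u, hu⟩ := surfP c hc hV (fun q hq hq' => hE q hq' hq) (fun q hq hq' => hE' q hq' hq)
    h1 h1'
  obtain ⟨W', hW', u', hu'⟩ := surfP c' hc' hV' (fun q hq hq' => hE q hq hq')
    (fun q hq hq' => hE' q hq hq') h2 h2'
  obtain ⟨F, hF, hFd⟩ := patch hW hu
  obtain ⟨G, hG, hGd⟩ := patch (F := F) (p := d') (inter_mem hW' hV') (u := u')
    (fun q hq hq' => (hu' q hq.1 hq').congrE (hF q hq.2))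
  have key : ∀ p, p ≠ d → p ≠ d' → LEq (fun x y => E x y + E' x y) G p := by
    intro p hp hp'
    obtain ⟨V, hV, h⟩ := hF p hp
    obtain ⟨V', hV', h'⟩ := hG p hp'
    exact ⟨V ∩ V', inter_mem hV hV', fun x hx y hy => by
      rw [h' x hx.2 y hy.2, h x hx.1 y hy.1]⟩
  refine ⟨G, fun p => ?_, key⟩
  by_cases hp : p = d
  · subst hp
    exact hFd.addAt.congrE (hG p hd)
  · by_cases hp' : p = d'
    · subst hp'
      exact hGd.addAt
    · exact AddAt.congrE ((hE p hp hp').add (hE' p hp hp')) (key p hp hp')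

lemma triple [T2Space S] [CompactSpace S] (hch : ∀ x : S, ∃ c : Ch S, c.g 0 = x) {d d' : S}
    (hd : d ≠ d') {E : ℕ → S → S → ZMod 2} (hE : ∀ n p, p ≠ d → p ≠ d' → AddAt (E n) p)
    (h1 : ∀ n, Nontriv (E n) d) (h2 : ∀ n, Nontriv (E n) d') :
    ∃ i j k : ℕ, i ≠ j ∧ i ≠ k ∧ j ≠ k ∧
      (∃ w : S → ZMod 2, ∀ p, p ≠ d → p ≠ d' → TrivAt (fun x y => E i x y + E j x y) w p) ∧
      (∃ w : S → ZMod 2, ∀ p, p ≠ d → p ≠ d' → TrivAt (fun x y => E i x y + E k x y) w p) := by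
  have := fun n => beta hch hd (hE n) (hE 0) (h1 n) (h1 0) (h2 n) (h2 0)
  choose β hβ hβE using this
  obtain ⟨I, hI, hII⟩ := finiteness hch β hβ
  obtain ⟨i, hi, -⟩ := hI.exists_gt 0
  obtain ⟨j, hj, hij⟩ := hI.exists_gt i
  obtain ⟨k, hk, hjk⟩ := hI.exists_gt j
  have tr : ∀ i ∈ I, ∀ j ∈ I, ∃ w : S → ZMod 2, ∀ p, p ≠ d → p ≠ d' →
      TrivAt (fun x y => E i x y + E j x y) w p := by
    intro i hi j hj
    obtain ⟨w, hw⟩ := hII i hi j hj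
    refine ⟨w, fun p hp hp' => (hw p).congrE ?_⟩
    obtain ⟨V, hV, h⟩ := hβE i p hp hp'
    obtain ⟨V', hV', h'⟩ := hβE j p hp hp'
    refine ⟨V ∩ V', inter_mem hV hV', fun x hx y hy => ?_⟩
    have e1 := h x hx.1 y hy.1
    have e2 := h' x hx.2 y hy.2
    grind
  exact ⟨i, j, k, by omega, by omega, by omega, tr i hi j hj, tr i hi k hk⟩

/-- The majority argument. -/
lemma kpart [T2Space S] [CompactSpace S] (hch : ∀ x : S, ∃ c : Ch S, c.g 0 = x) {d d' : S}
    (hd : d ≠ d') (f : ℕ → ℝ → S) (hf : ∀ n, Continuous (f n)) (hi : ∀ n, InjOn (f n) (Icc 0 1))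
    (hf0 : ∀ n, f n 0 = d) (hf1 : ∀ n, f n 1 = d')
    (hdis : ∀ n m, n ≠ m → Disjoint (f n '' Ioo 0 1) (f m '' Icc 0 1))
    (z : S) (q : ℕ → S) (hq : ∀ n, q n ∈ f n '' Ioo 0 1)
    (hNS : ∀ i j k, i ≠ j → i ≠ k → j ≠ k → ∀ h : S → ZMod 2,
      (∀ p, p ∉ f i '' Icc 0 1 → p ∉ f j '' Icc 0 1 → LC h p) → h z = h (q k)) : False := by
  choose E hE using fun n => arc_cocycle hch (hf n) (hi n)
  have hE1 : ∀ n p, p ≠ d → p ≠ d' → AddAt (E n) p := fun n p h h' =>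
    (hE n).1 p (by rwa [hf0]) (by rwa [hf1])
  have hE2 : ∀ n, Nontriv (E n) d := fun n => hf0 n ▸ (hE n).2.2.1
  have hE3 : ∀ n, Nontriv (E n) d' := fun n => hf1 n ▸ (hE n).2.2.2
  obtain ⟨i, j, k, hij, hik, hjk, ⟨wj, hwj⟩, ⟨wk, hwk⟩⟩ := triple hch hd hE1 hE2 hE3
  have hdA : ∀ n p, p ∉ f n '' Icc 0 1 → p ≠ d ∧ p ≠ d' := by
    intro n p hp
    constructor
    · rintro rfl; exact hp ⟨0, by simp, hf0 n⟩
    · rintro rfl; exact hp ⟨1, by simp, hf1 n⟩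
  have t0 : ∀ n p, p ∉ f n '' Icc 0 1 → TrivAt (E n) (fun _ => 0) p := fun n p hp => (hE n).2.1 p hp
  have tj : ∀ w (m : ℕ), (∀ p, p ≠ d → p ≠ d' → TrivAt (fun x y => E i x y + E m x y) w p) →
      ∀ p, p ∉ f m '' Icc 0 1 → TrivAt (E i) (fun x => w x + w z) p := by
    intro w m hw p hp
    have h1 := (hw p (hdA m p hp).1 (hdA m p hp).2).add (t0 m p hp)
    refine (h1.congrE ⟨univ, univ_mem, fun x _ y _ => ?_⟩).congru (Eventually.of_forall fun x => ?_)
    · grind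
    · grind
  set ui : S → ZMod 2 := fun _ => 0 with hui
  set uj : S → ZMod 2 := fun x => wj x + wj z with huj
  set uk : S → ZMod 2 := fun x => wk x + wk z with huk
  have Ti : ∀ p, p ∉ f i '' Icc 0 1 → TrivAt (E i) ui p := t0 i
  have Tj : ∀ p, p ∉ f j '' Icc 0 1 → TrivAt (E i) uj p := tj wj j hwj
  have Tk : ∀ p, p ∉ f k '' Icc 0 1 → TrivAt (E i) uk p := tj wk k hwk
  -- two trivialisations agree near the third arc
  have agree : ∀ (a b c : ℕ), a ≠ b → a ≠ c → b ≠ c → ∀ u v : S → ZMod 2, u z = 0 → v z = 0 →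
      (∀ p, p ∉ f a '' Icc 0 1 → TrivAt (E i) u p) → (∀ p, p ∉ f b '' Icc 0 1 → TrivAt (E i) v p) →
      ∀ p ∈ f c '' Ioo 0 1, ∀ᶠ x in 𝓝 p, u x = v x := by
    intro a b c hab hac hbc u v hu hv Tu Tv p hp
    have hL : ∀ p, p ∉ f a '' Icc 0 1 → p ∉ f b '' Icc 0 1 → LC (fun x => u x + v x) p :=
      fun p h h' => (Tu p h).lc (Tv p h')
    have h1 := hNS a b c hab hac hbc _ hL
    have hLc : ∀ p ∈ f c '' Ioo 0 1, LC (fun x => u x + v x) p := fun p hp =>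
      hL p (disjoint_left.1 (hdis c a hac.symm) hp) (disjoint_left.1 (hdis c b hbc.symm) hp)
    have h2 := LC.const_on (h := fun x => u x + v x)
      (isPreconnected_Ioo.image _ (hf c).continuousOn) hLc (hq c) hp
    have h3 := hLc p hp
    unfold LC at h3
    filter_upwards [h3] with x hx
    beta_reduce at h1 h2 hx
    grind
  have zi : ui z = 0 := rfl
  have zj : uj z = 0 := by simp only [huj]; grind
  have zk : uk z = 0 := by simp only [huk]; grind
  have Aij := agree i j k hij hik hjk ui uj zi zj Ti Tj
  have Aik := agree i k j hik hij hjk.symm ui uk zi zk Ti Tk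
  have Ajk := agree j k i hjk hij.symm hik.symm uj uk zj zk Tj Tk
  have sq : ∀ a : ZMod 2, a * a = a := by decide
  have hIo : ∀ n p, p ≠ d → p ≠ d' → p ∈ f n '' Icc 0 1 → p ∈ f n '' Ioo 0 1 := by
    rintro n _ h h' ⟨x, hx, rfl⟩
    refine ⟨x, ⟨lt_of_le_of_ne hx.1 ?_, lt_of_le_of_ne hx.2 ?_⟩, rfl⟩
    · rintro rfl; exact h (hf0 n)
    · rintro rfl; exact h' (hf1 n)
  refine hE2 i {x | x ≠ d'} (isOpen_ne.mem_nhds hd)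
    (fun x => ui x * uj x + uj x * uk x + ui x * uk x) fun p hp' hp => ?_
  have near : ∀ u v : S → ZMod 2, TrivAt (E i) u p → (∀ᶠ x in 𝓝 p, v x = u x) →
      TrivAt (E i) v p := by
    intro u v hu huv
    refine hu.congru ?_
    have := huv.self_of_nhds
    unfold LC
    filter_upwards [huv] with x hx
    grind
  by_cases hpi : p ∈ f i '' Icc 0 1
  · have h1 := hIo i p hp hp' hpi
    refine near uj _ (Tj p (disjoint_left.1 (hdis i j hij) h1)) ?_
    filter_upwards [Ajk p h1] with x hx
    have := sq (uj x)
    grind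
  by_cases hpj : p ∈ f j '' Icc 0 1
  · have h1 := hIo j p hp hp' hpj
    refine near ui _ (Ti p hpi) ?_
    filter_upwards [Aik p h1] with x hx
    have := sq (ui x)
    grind
  by_cases hpk : p ∈ f k '' Icc 0 1
  · have h1 := hIo k p hp hp' hpk
    refine near ui _ (Ti p hpi) ?_
    filter_upwards [Aij p h1] with x hx
    have := sq (ui x)
    grind
  · refine (Ti p hpi).congru ?_
    have l1 := (Ti p hpi).lc (Tj p hpj)
    have l2 := (Ti p hpi).lc (Tk p hpk)
    unfold LC at l1 l2 ⊢
    filter_upwards [l1, l2] with x h1 h2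
    simp only [hui] at h1 h2 ⊢
    grind

end

end Cradle

namespace Cradle

section
variable {X : Type*} [TopologicalSpace X]

/-- all cocycles are trivial -/
def AllTriv (X : Type*) [TopologicalSpace X] : Prop :=
  ∀ E : X → X → ZMod 2, (∀ p, AddAt E p) → ∃ u : X → ZMod 2, ∀ p, TrivAt E u p

/-- Janiszewski's lemma. -/
lemma jan [NormalSpace X] (hX : AllTriv X) {C₁ C₂ : Set X} (h₁ : IsClosed C₁) (h₂ : IsClosed C₂)
    (hd : Disjoint C₁ C₂) {h : X → ZMod 2} (hh : ∀ p, p ∉ C₁ → p ∉ C₂ → LC h p) {x y : X}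
    (hxy : h x ≠ h y) : (∃ h' : X → ZMod 2, (∀ p, p ∉ C₁ → LC h' p) ∧ h' x ≠ h' y) ∨
      (∃ h' : X → ZMod 2, (∀ p, p ∉ C₂ → LC h' p) ∧ h' x ≠ h' y) := by
  classical
  obtain ⟨N, N', hN, hN', hCN, hCN', hNN⟩ := normal_separation h₁ h₂ hd
  set E : X → X → ZMod 2 := fun x y => if x ∈ N ∧ y ∈ N then h x + h y else 0 with hE
  have t1 : ∀ p, p ∉ C₁ → TrivAt E (fun _ => 0) p := by
    intro p hp
    by_cases hp2 : p ∈ C₂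
    · refine ⟨N', hN'.mem_nhds (hCN' hp2), fun a ha b hb => ?_⟩
      simp only [hE]
      rw [if_neg fun hn => disjoint_left.1 hNN hn.1 ha]; rfl
    · obtain ⟨V, hV, hVh⟩ := trivAt_zero_iff.2 (hh p hp hp2)
      refine ⟨V, hV, fun a ha b hb => ?_⟩
      simp only [hE]
      split_ifs
      · rw [← hVh a ha b hb]; rfl
      · rfl
  have t2 : ∀ p, p ∉ C₂ → TrivAt E h p := by
    intro p hp
    by_cases hp1 : p ∈ C₁
    · refine ⟨N, hN.mem_nhds (hCN hp1), fun a ha b hb => ?_⟩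
      simp only [hE]
      rw [if_pos ⟨ha, hb⟩]
    · refine (t1 p hp1).congru ?_
      simpa using hh p hp1 hp
  obtain ⟨u, hu⟩ := hX E fun p => by
    by_cases hp : p ∈ C₁
    · exact (t2 p (disjoint_left.1 hd hp)).addAt
    · exact (t1 p hp).addAt
  by_cases hc : u x = u y
  · right
    refine ⟨fun x => h x + u x, fun p hp => (t2 p hp).lc (hu p), ?_⟩
    beta_reduce
    rw [hc]
    exact fun h => hxy (add_right_cancel h)
  · left
    refine ⟨u, fun p hp => ?_, hc⟩
    simpa using (t1 p hp).lc (hu p)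

lemma jan_finite [NormalSpace X] [PreconnectedSpace X] (hX : AllTriv X) {ι : Type*} (s : Finset ι)
    (C : ι → Set X) (hC : ∀ a ∈ s, IsClosed (C a)) (hd : ∀ a ∈ s, ∀ b ∈ s, a ≠ b → Disjoint (C a) (C b))
    {x y : X} {h : X → ZMod 2} (hh : ∀ p, (∀ a ∈ s, p ∉ C a) → LC h p) (hxy : h x ≠ h y) :
    ∃ a ∈ s, ∃ h' : X → ZMod 2, (∀ p, p ∉ C a → LC h' p) ∧ h' x ≠ h' y := by
  classical
  induction s using Finset.induction_on generalizing h with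
  | empty =>
    exact absurd (LC.const_on isPreconnected_univ (fun p _ => hh p (by simp)) (mem_univ x) (mem_univ y)) hxy
  | insert a s ha ih =>
    have hj := jan hX (C₁ := C a) (C₂ := ⋃ b ∈ s, C b) (hC a (by simp)) ?_ ?_ (h := h) ?_ hxy
    · rcases hj with hl | hr
      · obtain ⟨h', h1, h2⟩ := hl
        exact ⟨a, by simp, h', h1, h2⟩
      obtain ⟨h', h1, h2⟩ := hr
      obtain ⟨b, hb, h3⟩ := ih (fun a ha => hC a (by simp [ha]))
        (fun a ha b hb => hd a (by simp [ha]) b (by simp [hb])) (h := h')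
        (fun p hp => h1 p (by simpa using hp)) h2
      exact ⟨b, by simp [hb], h3⟩
    · exact isClosed_biUnion_finset fun b hb => hC b (by simp [hb])
    · rw [disjoint_iUnion₂_right]
      intro b hb
      exact hd a (by simp) b (by simp [hb]) (by rintro rfl; exact ha hb)
    · intro p hp hp'
      apply hh
      intro b hb
      rcases Finset.mem_insert.1 hb with rfl | hb
      · exact hp
      · exact fun h => hp' (mem_iUnion₂.2 ⟨b, hb, h⟩)

lemma LC.op2 {h h' : X → ZMod 2} {p : X} (a : LC h p) (b : LC h' p) (F : ZMod 2 → ZMod 2 → ZMod 2) :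
    LC (fun x => F (h x) (h' x)) p := by
  unfold LC at *
  filter_upwards [a, b] with x hx hx'
  rw [hx, hx']

/-- if `F k ·` is constant and `h` is locally constant with value `k`, then `F h h'` is
locally constant. -/
lemma LC.op_left {h : X → ZMod 2} {p : X} (a : LC h p) (h' : X → ZMod 2)
    (F : ZMod 2 → ZMod 2 → ZMod 2) (hF : ∀ x y, F (h p) x = F (h p) y) :
    LC (fun x => F (h x) (h' x)) p := by
  unfold LC at *
  filter_upwards [a] with x hx
  rw [hx]; exact hF _ _

lemma LC.op_right {h : X → ZMod 2} {p : X} (a : LC h p) (h' : X → ZMod 2)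
    (F : ZMod 2 → ZMod 2 → ZMod 2) (hF : ∀ x y, F x (h p) = F y (h p)) :
    LC (fun x => F (h' x) (h x)) p := by
  unfold LC at *
  filter_upwards [a] with x hx
  rw [hx]; exact hF _ _

/-- the order on separating sets -/
def Rl (z : X) (c : ℕ → Set X) (m n : ℕ) : Prop :=
  m ≠ n ∧ ∃ h : X → ZMod 2, (∀ p, p ∉ c m → LC h p) ∧ h z = 0 ∧ ∀ x ∈ c n, h x = 1

lemma zmod2 (a : ZMod 2) : a = 0 ∨ a = 1 := by revert a; decide

variable [PreconnectedSpace X] {z : X} {c : ℕ → Set X}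

lemma LC.all {h : X → ZMod 2} (hh : ∀ p, LC h p) (x y : X) : h x = h y :=
  LC.const_on isPreconnected_univ (fun p _ => hh p) (mem_univ x) (mem_univ y)

lemma Rl.asymm (hne : ∀ n, (c n).Nonempty) (hd : ∀ m n, m ≠ n → Disjoint (c m) (c n))
    {m n : ℕ} (h : Rl z c m n) (h' : Rl z c n m) : False := by
  obtain ⟨hmn, h1, a1, a2, a3⟩ := h
  obtain ⟨-, h2, b1, b2, b3⟩ := h'
  have key : ∀ p, LC (fun x => (fun a b => a + b + a * b : ZMod 2 → ZMod 2 → ZMod 2) (h1 x) (h2 x)) p := by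
    intro p
    by_cases hm : p ∈ c m
    · refine (b1 p (disjoint_left.1 (hd m n hmn) hm)).op_right h1 (fun a b => a + b + a * b) ?_
      rw [b3 p hm]; decide
    · by_cases hn : p ∈ c n
      · refine (a1 p hm).op_left h2 (fun a b => a + b + a * b) ?_
        rw [a3 p hn]; decide
      · exact (a1 p hm).op2 (b1 p hn) (fun a b => a + b + a * b)
  obtain ⟨x, hx⟩ := hne n
  have := LC.all key z x
  simp only [a2, b2, a3 x hx] at this
  rcases zmod2 (h2 x) with h | h <;> rw [h] at this <;> revert this <;> decide

lemma const_c (hc : ∀ n, IsPreconnected (c n)) (hd : ∀ m n, m ≠ n → Disjoint (c m) (c n))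
    {m n : ℕ} (hmn : m ≠ n) {h : X → ZMod 2} (hh : ∀ p, p ∉ c m → LC h p) :
    (∀ x ∈ c n, h x = 0) ∨ (∀ x ∈ c n, h x = 1) := by
  have key : ∀ x ∈ c n, ∀ y ∈ c n, h x = h y := fun x hx y hy =>
    LC.const_on (hc n) (fun p hp => hh p (disjoint_right.1 (hd m n hmn) hp)) hx hy
  by_cases hex : ∃ x ∈ c n, h x = 1
  · obtain ⟨x, hx, h1⟩ := hex
    right
    exact fun y hy => (key y hy x hx).trans h1
  · left
    intro x hx
    rcases zmod2 (h x) with h | h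
    · exact h
    · exact absurd ⟨x, hx, h⟩ hex

lemma Rl.trans (hne : ∀ n, (c n).Nonempty) (hc : ∀ n, IsPreconnected (c n))
    (hd : ∀ m n, m ≠ n → Disjoint (c m) (c n)) {k m n : ℕ} (h : Rl z c k m) (h' : Rl z c m n) :
    Rl z c k n := by
  have hkn : k ≠ n := by rintro rfl; exact h.asymm hne hd h'
  have has := h
  obtain ⟨hkm, h1, a1, a2, a3⟩ := h
  obtain ⟨hmn, h2, b1, b2, b3⟩ := h'
  refine ⟨hkn, ?_⟩
  rcases const_c hc hd hkn a1 with h0 | h0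
  · exfalso
    have h20 : ∀ x ∈ c k, h2 x = 0 := by
      rcases const_c hc hd hkm.symm b1 with h | h
      · exact h
      · exact absurd ⟨hkm.symm, h2, b1, b2, h⟩ (fun h => has.asymm hne hd h)
    have key : ∀ p, LC (fun x => (fun a b => (1 + a) * b : ZMod 2 → ZMod 2 → ZMod 2) (h1 x) (h2 x)) p := by
      intro p
      by_cases hm : p ∈ c k
      · refine (b1 p (disjoint_left.1 (hd k m hkm) hm)).op_right h1 (fun a b => (1 + a) * b) ?_
        rw [h20 p hm]; decide
      · by_cases hn : p ∈ c m
        · refine (a1 p hm).op_left h2 (fun a b => (1 + a) * b) ?_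
          rw [a3 p hn]; decide
        · exact (a1 p hm).op2 (b1 p hn) (fun a b => (1 + a) * b)
    obtain ⟨x, hx⟩ := hne n
    have := LC.all key z x
    simp only [a2, b2, h0 x hx, b3 x hx] at this
    revert this; decide
  · exact ⟨h1, a1, a2, h0⟩

lemma Rl.total (hc : ∀ n, IsPreconnected (c n))
    (hd : ∀ m n, m ≠ n → Disjoint (c m) (c n)) {m n : ℕ} (hmn : m ≠ n) {q : X} {h h' : X → ZMod 2}
    (a1 : ∀ p, p ∉ c m → LC h p) (b1 : ∀ p, p ∉ c n → LC h' p) (a2 : h z = 0) (b2 : h' z = 0)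
    (a3 : h q = 1) (b3 : h' q = 1) : Rl z c m n ∨ Rl z c n m := by
  rcases const_c hc hd hmn a1 with h0 | h0
  · rcases const_c hc hd hmn.symm b1 with h0' | h0'
    · exfalso
      have key : ∀ p, LC (fun x => (fun a b => a * b : ZMod 2 → ZMod 2 → ZMod 2) (h x) (h' x)) p := by
        intro p
        by_cases hm : p ∈ c m
        · refine (b1 p (disjoint_left.1 (hd m n hmn) hm)).op_right h _ ?_
          rw [h0' p hm]; decide
        · by_cases hn : p ∈ c n
          · refine (a1 p hm).op_left h' _ ?_
            rw [h0 p hn]; decide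
          · exact (a1 p hm).op2 (b1 p hn) _
      have := LC.all key z q
      simp only [a2, b2, a3, b3] at this
      revert this; decide
    · exact Or.inr ⟨hmn.symm, h', b1, b2, h0'⟩
  · exact Or.inl ⟨hmn, h, a1, a2, h0⟩

lemma linear_order (hne : ∀ n, (c n).Nonempty) (hc : ∀ n, IsPreconnected (c n))
    (hd : ∀ m n, m ≠ n → Disjoint (c m) (c n))
    (hs : ∀ m n, m ≠ n → ∃ q : X, (∃ h : X → ZMod 2, (∀ p, p ∉ c m → LC h p) ∧ h z ≠ h q) ∧
      (∃ h : X → ZMod 2, (∀ p, p ∉ c n → LC h p) ∧ h z ≠ h q)) :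
    ∃ g : ℕ → ℕ, StrictMono g ∧ ∀ i j k, i < j → j < k → ∀ x ∈ c (g i), ∀ y ∈ c (g k),
      ∃ h : X → ZMod 2, (∀ p, p ∉ c (g j) → LC h p) ∧ h x ≠ h y := by
  have norm : ∀ m q, (∃ h : X → ZMod 2, (∀ p, p ∉ c m → LC h p) ∧ h z ≠ h q) →
      ∃ h : X → ZMod 2, (∀ p, p ∉ c m → LC h p) ∧ h z = 0 ∧ h q = 1 := by
    rintro m q ⟨h, h1, h2⟩
    refine ⟨fun x => h x + h z, fun p hp => ?_, by grind, ?_⟩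
    · have := h1 p hp
      unfold LC at *
      filter_upwards [this] with x hx
      rw [hx]
    · have : ∀ a b : ZMod 2, a ≠ b → b + a = 1 := by decide
      exact this _ _ h2
  have tot : ∀ m n, m ≠ n → Rl z c m n ∨ Rl z c n m := by
    intro m n hmn
    obtain ⟨q, hm, hn⟩ := hs m n hmn
    obtain ⟨h, a1, a2, a3⟩ := norm m q hm
    obtain ⟨h', b1, b2, b3⟩ := norm n q hn
    exact Rl.total hc hd hmn a1 b1 a2 b2 a3 b3
  have use : ∀ i j k, Rl z c j i → Rl z c k j → ∀ x ∈ c i, ∀ y ∈ c k,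
      ∃ h : X → ZMod 2, (∀ p, p ∉ c j → LC h p) ∧ h x = 1 ∧ h y = 0 := by
    rintro i j k hji hkj x hx y hy
    obtain ⟨-, h, a1, a2, a3⟩ := hji
    refine ⟨h, a1, a3 x hx, ?_⟩
    rcases const_c hc hd hkj.1.symm a1 with h0 | h0
    · exact h0 y hy
    · exact (hkj.asymm hne hd ⟨hkj.1.symm, h, a1, a2, h0⟩).elim
  haveI : IsTrans ℕ (Rl z c) := ⟨fun _ _ _ h h' => h.trans hne hc hd h'⟩
  obtain ⟨g, hg⟩ := exists_increasing_or_nonincreasing_subseq (Rl z c) id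
  refine ⟨g, g.strictMono, fun i j k hij hjk x hx y hy => ?_⟩
  rcases hg with hg | hg
  · obtain ⟨h, h1, h2, h3⟩ := use (g k) (g j) (g i) (hg j k hjk) (hg i j hij) y hy x hx
    exact ⟨h, h1, by rw [h2, h3]; decide⟩
  · have r1 : Rl z c (g j) (g i) :=
      (tot (g i) (g j) (g.strictMono hij).ne).resolve_left (hg i j hij)
    have r2 : Rl z c (g k) (g j) :=
      (tot (g j) (g k) (g.strictMono hjk).ne).resolve_left (hg j k hjk)
    obtain ⟨h, h1, h2, h3⟩ := use (g i) (g j) (g k) r1 r2 x hx y hy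
    exact ⟨h, h1, by rw [h2, h3]; decide⟩

end

end Cradle

namespace Cradle

lemma pre_preconn {Y : Type*} [TopologicalSpace Y] {B T : Set Y} (hT : IsPreconnected T) (hTB : T ⊆ B) :
    IsPreconnected ((fun x : B => (x : Y)) ⁻¹' T) := by
  rw [← Topology.IsInducing.subtypeVal.isPreconnected_image]
  have : (Subtype.val '' ((fun x : B => (x : Y)) ⁻¹' T)) = T := by
    ext x
    constructor
    · rintro ⟨y, hy, rfl⟩; exact hy
    · intro hx; exact ⟨⟨x, hTB hx⟩, hx, rfl⟩
  rw [this]; exact hT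

section
variable {V : Type*} [NormedAddCommGroup V] [NormedSpace ℝ V]

lemma ball_near {p : V} (hp : p ∈ closedBall (0 : V) 1) {ε : ℝ} (hε : 0 < ε) :
    (ball p ε ∩ ball (0 : V) 1).Nonempty := by
  have : p ∈ closure (ball (0 : V) 1) := by
    rw [closure_ball _ one_ne_zero]; exact hp
  obtain ⟨x, hx, hd⟩ := Metric.mem_closure_iff.1 this ε hε
  exact ⟨x, by rwa [mem_ball, dist_comm], hx⟩

lemma modelM {ι : Type*} (s : Finset ι) (C : ι → Set V) (hC : ∀ a ∈ s, IsClosed (C a))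
    (hd : ∀ a ∈ s, ∀ b ∈ s, a ≠ b → Disjoint (C a ∩ ball 0 1) (C b))
    (h : closedBall (0 : V) 1 → ZMod 2)
    (hh : ∀ p : closedBall (0 : V) 1, (p : V) ∈ ball (0 : V) 1 → (∀ a ∈ s, (p : V) ∉ C a) → LC h p)
    (z q : closedBall (0 : V) 1) (hz : (z : V) ∈ ball (0 : V) 1) (hzC : ∀ a ∈ s, (z : V) ∉ C a)
    (hqC : ∀ a ∈ s, (q : V) ∉ C a) (hLq : LC h q) (hzq : h z ≠ h q) :
    ∃ a ∈ s, ∃ h' : closedBall (0 : V) 1 → ZMod 2, (∀ p : closedBall (0 : V) 1, (p : V) ∉ C a → LC h' p)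
      ∧ h' z ≠ h' q := by
  classical
  -- choose a small ball around `q`
  obtain ⟨ε, hε, hεC, hεh⟩ : ∃ ε > 0, (∀ a ∈ s, Disjoint (ball (q : V) ε) (C a)) ∧
      ∀ p : closedBall (0 : V) 1, (p : V) ∈ ball (q : V) ε → h p = h q := by
    have e1 : ∀ᶠ x in 𝓝 (q : V), ∀ a ∈ s, x ∉ C a := by
      rw [Filter.eventually_all_finset]
      intro a ha
      exact (hC a ha).isOpen_compl.mem_nhds (hqC a ha)
    have e2 : ∀ᶠ x in 𝓝 (q : V), ∀ hx : x ∈ closedBall (0 : V) 1, h ⟨x, hx⟩ = h q := by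
      have := hLq
      unfold LC at this
      rw [nhds_subtype_eq_comap, eventually_comap] at this
      filter_upwards [this] with x hx hx'
      exact hx ⟨x, hx'⟩ rfl
    obtain ⟨ε, hε, hb⟩ := Metric.eventually_nhds_iff_ball.1 (e1.and e2)
    exact ⟨ε, hε, fun a ha => disjoint_left.2 fun x hx => (hb x hx).1 a ha,
      fun p hp => (hb p hp).2 p.2⟩
  obtain ⟨q', hq'1, hq'2⟩ := ball_near q.2 hε
  let ι0 : ball (0 : V) 1 → closedBall (0 : V) 1 := fun x => ⟨x, ball_subset_closedBall x.2⟩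
  have hι0 : Continuous ι0 := by fun_prop
  have hall : AllTriv (ball (0 : V) 1) := fun E hE =>
    star_triv (c := (0 : V)) (by simp) ((convex_ball (0 : V) 1).starConvex (by simp)) E hE
  haveI : PreconnectedSpace (ball (0 : V) 1) :=
    isPreconnected_iff_preconnectedSpace.1 (convex_ball (0 : V) 1).isPreconnected
  have hj := jan_finite hall s (fun a => (fun x : ball (0 : V) 1 => (x : V)) ⁻¹' C a)
    (fun a ha => (hC a ha).preimage continuous_subtype_val) ?_ (x := ⟨z, hz⟩) (y := ⟨q', hq'2⟩)
    (h := fun x => h (ι0 x)) ?_ ?_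
  rotate_left
  · intro a ha b hb hab
    rw [disjoint_left]
    intro x hx hx'
    exact disjoint_left.1 (hd a ha b hb hab) ⟨hx, x.2⟩ hx'
  · intro p hp
    exact (hh (ι0 p) p.2 hp).comp hι0.continuousAt
  · rw [hεh (ι0 ⟨q', hq'2⟩) hq'1]
    exact hzq
  obtain ⟨a, ha, h1, h1c, h1n⟩ := hj
  refine ⟨a, ha, ?_⟩
  let g : V → ZMod 2 := fun x => if hx : x ∈ ball (0 : V) 1 then h1 ⟨x, hx⟩ else 0
  have hg : ∀ x (hx : x ∈ ball (0 : V) 1), g x = h1 ⟨x, hx⟩ := fun x hx => dif_pos hx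
  let h' : V → ZMod 2 := fun p => if ∀ᶠ x in 𝓝[ball (0 : V) 1] p, g x = 1 then 1 else 0
  have claim : ∀ (p : V) (δ : ℝ) (k : ZMod 2), (∀ x ∈ ball p δ ∩ ball (0 : V) 1, g x = k) →
      ∀ p' ∈ ball p δ ∩ closedBall (0 : V) 1, h' p' = k := by
    intro p δ k hk p' hp'
    have ev : ∀ᶠ x in 𝓝[ball (0 : V) 1] p', g x = k := by
      filter_upwards [self_mem_nhdsWithin, mem_nhdsWithin_of_mem_nhds (isOpen_ball.mem_nhds hp'.1)] with x h1 h2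
      exact hk x ⟨h2, h1⟩
    haveI : (𝓝[ball (0 : V) 1] p').NeBot := by
      rw [← mem_closure_iff_nhdsWithin_neBot, closure_ball _ one_ne_zero]
      exact hp'.2
    simp only [h']
    rcases zmod2 k with rfl | rfl
    · rw [if_neg]
      intro h2
      obtain ⟨x, hx, hx'⟩ := (ev.and h2).exists
      rw [hx] at hx'
      exact absurd hx' (by decide)
    · rw [if_pos ev]
  have gconst : ∀ (p : V) (δ : ℝ), Disjoint (ball p δ) (C a) →
      ∀ x ∈ ball p δ ∩ ball (0 : V) 1, ∀ y ∈ ball p δ ∩ ball (0 : V) 1, g x = g y := by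
    intro p δ hdis x hx y hy
    rw [hg x hx.2, hg y hy.2]
    have hp := pre_preconn (B := ball (0 : V) 1)
      (((convex_ball p δ).inter (convex_ball (0 : V) 1)).isPreconnected) inter_subset_right
    exact LC.const_on hp (fun r hr => h1c r (disjoint_left.1 hdis hr.1)) hx hy
  have hloc : ∀ p : V, p ∉ C a → ∃ δ > 0, Disjoint (ball p δ) (C a) := by
    intro p hp
    obtain ⟨δ, hδ, hb⟩ := Metric.mem_nhds_iff.1 ((hC a ha).isOpen_compl.mem_nhds hp)
    exact ⟨δ, hδ, disjoint_left.2 hb⟩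
  refine ⟨fun p => h' p, ?_, ?_⟩
  · intro p hp
    obtain ⟨δ, hδ, hdis⟩ := hloc p hp
    obtain ⟨x, hx⟩ := ball_near p.2 hδ
    have hc := claim p δ (g x) (fun y hy => gconst p δ hdis y hy x hx)
    have : ∀ᶠ y : closedBall (0 : V) 1 in 𝓝 p, (y : V) ∈ ball (p : V) δ :=
      continuous_subtype_val.continuousAt.preimage_mem_nhds (ball_mem_nhds _ hδ)
    unfold LC
    filter_upwards [this] with y hy
    rw [hc y ⟨hy, y.2⟩, hc p ⟨mem_ball_self hδ, p.2⟩]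
  · have e1 : h' z = g z := by
      obtain ⟨δ, hδ, hdis⟩ := hloc z (hzC a ha)
      exact claim z δ (g z) (fun y hy => gconst z δ hdis y hy z ⟨mem_ball_self hδ, hz⟩) z
        ⟨mem_ball_self hδ, z.2⟩
    have e2 : h' q = g q' :=
      claim q ε (g q') (fun y hy => gconst q ε (hεC a ha) y hy q' ⟨hq'1, hq'2⟩) q
        ⟨mem_ball_self hε, q.2⟩
    beta_reduce
    rw [e1, e2, hg _ hz, hg _ hq'2]
    exact h1n
end

end Cradle

namespace Cradle

section
variable {S : Type*} [TopologicalSpace S]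

abbrev E2 := EuclideanSpace ℝ (Fin 2)

lemma int_disc (hch : ∀ x : S, ∃ c : Ch S, c.g 0 = x) {D : Set S}
    (Φ : D ≃ₜ closedBall (0 : E2) 1) (x : D) (hx : (Φ x : E2) ∈ ball (0 : E2) 1) :
    (x : S) ∈ interior D := by
  obtain ⟨c, hc⟩ := hch x
  have hxr : (x : S) ∈ range c.g := ⟨0, hc⟩
  let L := Complex.orthonormalBasisOneI.repr
  let K := closedBall (0 : E2) 1
  let ψ : K → S := fun v => (Φ.symm v : S)
  have hψ : Continuous ψ := by fun_prop
  have hψx : ψ (Φ x) = x := by simp [ψ]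
  obtain ⟨ε, hε, hb⟩ : ∃ ε > 0, ∀ v ∈ closedBall (Φ x : E2) ε, ∃ hv : v ∈ K, ψ ⟨v, hv⟩ ∈ range c.g := by
    have e1 : ∀ᶠ v in 𝓝 (Φ x : E2), v ∈ ball (0 : E2) 1 := isOpen_ball.mem_nhds hx
    have e2 : ∀ᶠ v in 𝓝 (Φ x : E2), ∀ hv : v ∈ K, ψ ⟨v, hv⟩ ∈ range c.g := by
      have : ∀ᶠ v in 𝓝 (Φ x), ψ v ∈ range c.g :=
        hψ.continuousAt.preimage_mem_nhds (c.emb.isOpen_range.mem_nhds (by rw [hψx]; exact hxr))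
      rw [nhds_subtype_eq_comap, eventually_comap] at this
      filter_upwards [this] with v hv hv'
      exact hv ⟨v, hv'⟩ rfl
    obtain ⟨ε, hε, hb⟩ := Metric.nhds_basis_closedBall.eventually_iff.1 (e1.and e2)
    refine ⟨ε, hε, fun v hv => ?_⟩
    have hv1 : v ∈ K := ball_subset_closedBall (hb hv).1
    exact ⟨hv1, (hb hv).2 hv1⟩
  classical
  let a : ℂ → E2 := fun w => (Φ x : E2) + ε • L w
  have ha : Continuous a := by fun_prop
  have hab : ∀ w ∈ closedBall (0 : ℂ) 1, a w ∈ closedBall (Φ x : E2) ε := by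
    intro w hw
    simp only [a, mem_closedBall, dist_self_add_left, norm_smul, LinearIsometryEquiv.norm_map]
    rw [mem_closedBall_zero_iff] at hw
    rw [Real.norm_of_nonneg hε.le]
    nlinarith
  let F : ℂ → ℂ := fun w => if hw : a w ∈ K then c.z (ψ ⟨a w, hw⟩) else 0
  have hF : ∀ w (hw : w ∈ closedBall (0 : ℂ) 1), F w = c.z (ψ ⟨a w, (hb _ (hab w hw)).1⟩) :=
    fun w hw => dif_pos _
  have hr : ∀ w (hw : w ∈ closedBall (0 : ℂ) 1), ψ ⟨a w, (hb _ (hab w hw)).1⟩ ∈ range c.g :=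
    fun w hw => (hb _ (hab w hw)).2
  have key := invdom (F := F) ?_ ?_ ?_
  · have h2 := c.emb.isOpenMap.image_mem_nhds key
    rw [hc] at h2
    rw [mem_interior_iff_mem_nhds]
    refine mem_of_superset h2 ?_
    rintro _ ⟨_, ⟨w, hw, rfl⟩, rfl⟩
    rw [hF w hw, c.gz (hr w hw)]
    exact Subtype.coe_prop _
  · rw [continuousOn_iff_continuous_domRestrict, continuous_iff_continuousAt]
    intro w
    have e : (closedBall (0 : ℂ) 1).domRestrict F =
        fun w : closedBall (0 : ℂ) 1 => c.z (ψ ⟨a w, (hb _ (hab w w.2)).1⟩) :=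
      funext fun w => hF w w.2
    rw [e]
    have h1 : ContinuousAt c.z (ψ ⟨a w, (hb _ (hab w w.2)).1⟩) := c.zcont (hr w w.2)
    have h2 : Continuous fun w : closedBall (0 : ℂ) 1 => ψ ⟨a w, (hb _ (hab w w.2)).1⟩ := by
      apply hψ.comp
      fun_prop
    exact ContinuousAt.comp (f := fun w : closedBall (0 : ℂ) 1 => ψ ⟨a w, (hb _ (hab w w.2)).1⟩) h1
      h2.continuousAt
  · intro w hw w' hw' h
    rw [hF w hw, hF w' hw'] at h
    have h2 := congrArg c.g h
    rw [c.gz (hr w hw), c.gz (hr w' hw')] at h2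
    have h3 := Φ.symm.injective (Subtype.ext h2)
    have h4 : a w = a w' := congrArg Subtype.val h3
    simp only [a, add_right_inj] at h4
    exact L.injective (smul_right_injective _ hε.ne' h4)
  · have h0 : (0 : ℂ) ∈ closedBall (0 : ℂ) 1 := by simp
    rw [hF 0 h0]
    have : (⟨a 0, (hb _ (hab 0 h0)).1⟩ : K) = Φ x := by
      apply Subtype.ext; simp [a]
    rw [this, hψx, ← hc, c.zg]

/-- separation in the space `X` -/
def Sep {X : Type*} [TopologicalSpace X] (A : Set X) (z q : X) : Prop :=
  ∃ h : X → ZMod 2, (∀ p, p ∉ A → LC h p) ∧ h z ≠ h q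

lemma discM {X : Type*} [TopologicalSpace X] (Φ : X ≃ₜ closedBall (0 : E2) 1)
    {ι : Type*} (s : Finset ι) (C : ι → Set X) (hC : ∀ a ∈ s, IsClosed (C a))
    (hd : ∀ a ∈ s, ∀ b ∈ s, a ≠ b → ∀ x ∈ C a, x ∈ C b → (Φ x : E2) ∉ ball (0 : E2) 1)
    (h : X → ZMod 2)
    (hh : ∀ p, (Φ p : E2) ∈ ball (0 : E2) 1 → (∀ a ∈ s, p ∉ C a) → LC h p)
    (z q : X) (hz : (Φ z : E2) ∈ ball (0 : E2) 1) (hzC : ∀ a ∈ s, z ∉ C a)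
    (hqC : ∀ a ∈ s, q ∉ C a) (hLq : LC h q) (hzq : h z ≠ h q) :
    ∃ a ∈ s, Sep (C a) z q := by
  have hmem : ∀ (a : ι) (p : closedBall (0 : E2) 1), (p : E2) ∈ Subtype.val '' (Φ '' C a) ↔ Φ.symm p ∈ C a := by
    intro a p
    constructor
    · rintro ⟨_, ⟨x, hx, rfl⟩, he⟩
      rw [← Subtype.ext he]; simpa using hx
    · intro hp
      exact ⟨p, ⟨_, hp, by simp⟩, rfl⟩
  have hm := modelM (V := E2) s (fun a => Subtype.val '' (Φ '' C a)) ?_ ?_ (fun p => h (Φ.symm p)) ?_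
    (Φ z) (Φ q) hz ?_ ?_ ?_ ?_
  · obtain ⟨a, ha, h', h1, h2⟩ := hm
    refine ⟨a, ha, fun x => h' (Φ x), fun p hp => ?_, h2⟩
    refine (h1 (Φ p) ?_).comp Φ.continuous.continuousAt
    rw [hmem]; simpa using hp
  · intro a ha
    have h1 : IsClosed (Φ '' C a) := Φ.isClosedMap _ (hC a ha)
    exact isClosed_closedBall.isClosedMap_subtype_val _ h1
  · intro a ha b hb hab
    rw [disjoint_left]
    rintro _ ⟨⟨_, ⟨x, hx, rfl⟩, rfl⟩, hx1⟩ hx2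
    rw [hmem] at hx2
    exact hd a ha b hb hab x hx (by simpa using hx2) hx1
  · intro p hp hpa
    refine LC.comp (h := h) (f := Φ.symm) ?_ Φ.symm.continuous.continuousAt
    exact hh _ (by simpa using hp) fun a ha h => hpa a ha ((hmem a p).2 h)
  · intro a ha; rw [hmem]; simpa using hzC a ha
  · intro a ha; rw [hmem]; simpa using hqC a ha
  · refine LC.comp (h := h) (f := Φ.symm) ?_ Φ.symm.continuous.continuousAt
    simpa using hLq
  · simpa using hzq

end

end Cradle

namespace Cradle

section
variable {S : Type*} [TopologicalSpace S]

/-- `f` restricted to `[s,t]` is a chord of `D` -/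
structure Chd (D : Set S) (f : ℝ → S) (s t : ℝ) : Prop where
  lt : s < t
  s0 : 0 ≤ s
  t1 : t ≤ 1
  fs : f s ∈ frontier D
  ft : f t ∈ frontier D
  int : ∀ τ ∈ Ioo s t, f τ ∈ interior D

lemma not_int_frontier {D : Set S} {x : S} (h1 : x ∈ frontier D) (h2 : x ∈ interior D) : False :=
  h1.2 h2

variable {D : Set S} {f : ℝ → S}

lemma Chd.inter (hi : InjOn f (Icc 0 1)) {s t s' t' : ℝ} (h : Chd D f s t) (h' : Chd D f s' t')
    (hne : ¬ (s = s' ∧ t = t')) {x : S} (hx : x ∈ f '' Icc s t) (hx' : x ∈ f '' Icc s' t') :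
    x ∉ interior D := by
  intro hD
  obtain ⟨τ, hτ, rfl⟩ := hx
  obtain ⟨τ', hτ', he⟩ := hx'
  have : τ' = τ := hi ⟨h'.s0.trans hτ'.1, hτ'.2.trans h'.t1⟩ ⟨h.s0.trans hτ.1, hτ.2.trans h.t1⟩ he
  subst this
  have n1 : τ' ≠ s := by rintro rfl; exact not_int_frontier h.fs hD
  have n2 : τ' ≠ t := by rintro rfl; exact not_int_frontier h.ft hD
  have n3 : τ' ≠ s' := by rintro rfl; exact not_int_frontier h'.fs hD
  have n4 : τ' ≠ t' := by rintro rfl; exact not_int_frontier h'.ft hD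
  have l1 := lt_of_le_of_ne hτ.1 n1.symm
  have l2 := lt_of_le_of_ne hτ.2 n2
  have l3 := lt_of_le_of_ne hτ'.1 n3.symm
  have l4 := lt_of_le_of_ne hτ'.2 n4
  apply hne
  constructor
  · rcases lt_trichotomy s s' with hl | hl | hl
    · exact (not_int_frontier h'.fs (h.int s' ⟨hl, by linarith⟩)).elim
    · exact hl
    · exact (not_int_frontier h.fs (h'.int s ⟨hl, by linarith⟩)).elim
  · rcases lt_trichotomy t t' with hl | hl | hl
    · exact (not_int_frontier h.ft (h'.int t ⟨by linarith, hl⟩)).elim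
    · exact hl
    · exact (not_int_frontier h'.ft (h.int t' ⟨by linarith, hl⟩)).elim

lemma conn_int {T : Set S} (hT : IsPreconnected T) (hTf : ∀ x ∈ T, x ∉ frontier D) {x : S}
    (hx : x ∈ T) (hxD : x ∈ interior D) : T ⊆ interior D := by
  apply hT.subset_left_of_subset_union isOpen_interior (isOpen_compl_iff.2 isClosed_closure)
    (v := (closure D)ᶜ)
  · rw [disjoint_left]
    exact fun y hy hy' => hy' (subset_closure (interior_subset hy))
  · intro y hy
    by_cases h : y ∈ closure D
    · left
      by_contra hc
      exact hTf y hy ⟨h, hc⟩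
    · exact Or.inr h
  · exact ⟨x, hx, hxD⟩

lemma exists_frontier (hf : Continuous f) {a b : ℝ} (ha : f a ∈ interior D) (hb : f b ∉ D) :
    ∃ τ ∈ uIcc a b, f τ ∈ frontier D := by
  by_contra hc
  push Not at hc
  have h1 : IsPreconnected (f '' uIcc a b) := isPreconnected_uIcc.image f hf.continuousOn
  have h2 := conn_int (D := D) h1 (by rintro _ ⟨τ, hτ, rfl⟩; exact hc τ hτ) ⟨a, left_mem_uIcc, rfl⟩ ha
  exact hb (interior_subset (h2 ⟨b, right_mem_uIcc, rfl⟩))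

lemma exists_chd (hf : Continuous f) (h0 : f 0 ∉ D) (h1 : f 1 ∉ D)
    (hfin : {τ | τ ∈ Icc (0 : ℝ) 1 ∧ f τ ∈ frontier D}.Finite) {τ : ℝ} (hτ : τ ∈ Icc (0 : ℝ) 1)
    (hτD : f τ ∈ interior D) : ∃ s t, Chd D f s t ∧ τ ∈ Ioo s t := by
  obtain ⟨a, ha, haf⟩ := exists_frontier hf hτD h0
  obtain ⟨b, hb, hbf⟩ := exists_frontier hf hτD h1
  rw [uIcc_of_ge hτ.1] at ha
  rw [uIcc_of_le hτ.2] at hb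
  have f1 : {σ | σ ∈ Icc (0 : ℝ) 1 ∧ f σ ∈ frontier D ∧ σ ≤ τ}.Finite :=
    hfin.subset fun σ h => ⟨h.1, h.2.1⟩
  have f2 : {σ | σ ∈ Icc (0 : ℝ) 1 ∧ f σ ∈ frontier D ∧ τ ≤ σ}.Finite :=
    hfin.subset fun σ h => ⟨h.1, h.2.1⟩
  obtain ⟨s, ⟨hs1, hs2, hs3⟩, hs⟩ := f1.exists_maximalFor id _ ⟨a, ⟨ha.1, ha.2.trans hτ.2⟩, haf, ha.2⟩
  obtain ⟨t, ⟨ht1, ht2, ht3⟩, ht⟩ := f2.exists_minimalFor id _ ⟨b, ⟨hτ.1.trans hb.1, hb.2⟩, hbf, hb.1⟩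
  have hsτ : s < τ := lt_of_le_of_ne hs3 (by rintro rfl; exact not_int_frontier hs2 hτD)
  have hτt : τ < t := lt_of_le_of_ne ht3 (by rintro rfl; exact not_int_frontier ht2 hτD)
  refine ⟨s, t, ⟨hsτ.trans hτt, hs1.1, ht1.2, hs2, ht2, ?_⟩, hsτ, hτt⟩
  have h1 : IsPreconnected (f '' Ioo s t) := isPreconnected_Ioo.image f hf.continuousOn
  have h2 := conn_int (D := D) h1 ?_ ⟨τ, ⟨hsτ, hτt⟩, rfl⟩ hτD
  · exact fun σ hσ => h2 ⟨σ, hσ, rfl⟩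
  · rintro _ ⟨σ, hσ, rfl⟩ hfr
    rcases le_total σ τ with hl | hl
    · have := hs (j := σ) ⟨⟨hs1.1.trans hσ.1.le, hl.trans hτ.2⟩, hfr, hl⟩ hσ.1.le
      exact absurd hσ.1 (not_lt.2 this)
    · have := ht (j := σ) ⟨⟨hτ.1.trans hl, hσ.2.le.trans ht1.2⟩, hfr, hl⟩ hσ.2.le
      exact absurd hσ.2 (not_lt.2 this)

lemma Chd.subD (hD : IsClosed D) {s t : ℝ} (h : Chd D f s t) : f '' Icc s t ⊆ D := by
  rintro _ ⟨τ, hτ, rfl⟩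
  rcases hτ.1.eq_or_lt with rfl | h1
  · exact hD.frontier_subset h.fs
  rcases hτ.2.eq_or_lt with rfl | h2
  · exact hD.frontier_subset h.ft
  exact interior_subset (h.int τ ⟨h1, h2⟩)

lemma Chd.isChord (hD : IsClosed D) (hf : Continuous f) (hi : InjOn f (Icc 0 1)) {s t : ℝ}
    (h : Chd D f s t) : IsChord D (f '' Icc s t) := by
  have hst : 0 < t - s := sub_pos.2 h.lt
  refine ⟨f s, f t, ⟨fun u => f (s + u * (t - s)), by fun_prop, ?_, ?_, by simp, by simp⟩,
    h.subD hD, ?_⟩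
  · intro u v huv
    have hm : ∀ u : Icc (0 : ℝ) 1, s + u * (t - s) ∈ Icc (0 : ℝ) 1 := fun u => by
      have h1 := u.2.1
      have h2 := u.2.2
      have := h.s0
      have := h.t1
      constructor <;> nlinarith
    have := hi (hm u) (hm v) huv
    apply Subtype.ext
    have h3 : (u : ℝ) * (t - s) = v * (t - s) := by linarith
    exact mul_right_cancel₀ hst.ne' h3
  · ext x
    constructor
    · rintro ⟨u, rfl⟩
      have h1 := u.2.1
      have h2 := u.2.2
      refine ⟨_, ⟨?_, ?_⟩, rfl⟩ <;> nlinarith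
    · rintro ⟨τ, hτ, rfl⟩
      refine ⟨⟨(τ - s) / (t - s), div_nonneg (by linarith [hτ.1]) hst.le,
        (div_le_one hst).2 (by linarith [hτ.2])⟩, ?_⟩
      beta_reduce
      congr 1
      field_simp
      ring
  · ext x
    constructor
    · rintro ⟨⟨τ, hτ, rfl⟩, hfr⟩
      rcases hτ.1.eq_or_lt with rfl | h1
      · exact Or.inl rfl
      rcases hτ.2.eq_or_lt with rfl | h2
      · exact Or.inr rfl
      exact (not_int_frontier hfr (h.int τ ⟨h1, h2⟩)).elim
    · rintro (rfl | rfl)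
      · exact ⟨⟨s, left_mem_Icc.2 h.lt.le, rfl⟩, h.fs⟩
      · exact ⟨⟨t, right_mem_Icc.2 h.lt.le, rfl⟩, h.ft⟩

/-- If the arc `A` separates `z` from `q` in `D`, then one of its chords does; moreover the choice
is from a finite set. -/
lemma sep_chord [T2Space S] (hch : ∀ x : S, ∃ c : Ch S, c.g 0 = x)
    (Φ : D ≃ₜ closedBall (0 : E2) 1) (hf : Continuous f) (hi : InjOn f (Icc 0 1))
    (h0 : f 0 ∉ D) (h1 : f 1 ∉ D)
    (hfin : {τ | τ ∈ Icc (0 : ℝ) 1 ∧ f τ ∈ frontier D}.Finite) (z : D)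
    (hz : (Φ z : E2) ∈ ball (0 : E2) 1) (hzA : (z : S) ∉ f '' Icc 0 1) :
    ∃ P : Finset (ℝ × ℝ), (∀ a ∈ P, Chd D f a.1 a.2) ∧
      ∀ q : D, (q : S) ∉ f '' Icc 0 1 → Sep ((fun x : D => (x : S)) ⁻¹' (f '' Icc 0 1)) z q →
        ∃ a ∈ P, Sep ((fun x : D => (x : S)) ⁻¹' (f '' Icc a.1 a.2)) z q := by
  classical
  let P := (hfin.toFinset ×ˢ hfin.toFinset).filter fun a => Chd D f a.1 a.2
  have hP : ∀ a : ℝ × ℝ, a ∈ P ↔ Chd D f a.1 a.2 := by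
    intro a
    simp only [P, Finset.mem_filter, Finset.mem_product, Set.Finite.mem_toFinset, and_iff_right_iff_imp]
    intro h
    exact ⟨⟨⟨h.s0, h.lt.le.trans h.t1⟩, h.fs⟩, ⟨h.s0.trans h.lt.le, h.t1⟩, h.ft⟩
  have hsub : ∀ a ∈ P, f '' Icc a.1 a.2 ⊆ f '' Icc 0 1 := fun a ha =>
    image_mono (Icc_subset_Icc ((hP a).1 ha).s0 ((hP a).1 ha).t1)
  refine ⟨P, fun a ha => (hP a).1 ha, fun q hq ⟨h, hh, hzq⟩ => ?_⟩
  refine discM Φ P (fun a => (fun x : D => (x : S)) ⁻¹' (f '' Icc a.1 a.2)) ?_ ?_ h ?_ z q hz ?_ ?_ ?_ hzq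
  · intro a ha
    exact (isCompact_Icc.image hf).isClosed.preimage continuous_subtype_val
  · intro a ha b hb hab x hx hx' hxB
    refine Chd.inter hi ((hP a).1 ha) ((hP b).1 hb) ?_ hx hx' (int_disc hch Φ x hxB)
    rintro ⟨e1, e2⟩
    exact hab (Prod.ext e1 e2)
  · intro p hp hpa
    apply hh
    rintro ⟨τ, hτ, he⟩
    have hpi := int_disc hch Φ p hp
    obtain ⟨s, t, hst, hτ'⟩ := exists_chd hf h0 h1 hfin hτ (by rw [he]; exact hpi)
    exact hpa (s, t) ((hP _).2 hst) ⟨τ, Ioo_subset_Icc_self hτ', he⟩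
  · intro a ha h; exact hzA (hsub a ha h)
  · intro a ha h; exact hq (hsub a ha h)
  · exact hh q hq

end

end Cradle

namespace Cradle

lemma allTriv_disc {X : Type*} [TopologicalSpace X] (Φ : X ≃ₜ closedBall (0 : E2) 1) : AllTriv X := by
  intro E hE
  obtain ⟨u, hu⟩ := star_triv (c := (0 : E2)) (K := closedBall (0 : E2) 1) (by simp)
    ((convex_closedBall (0 : E2) 1).starConvex (by simp))
    (fun a b => E (Φ.symm a) (Φ.symm b)) (fun p => (hE _).comp Φ.symm.continuous.continuousAt)
  refine ⟨fun x => u (Φ x), fun p => ?_⟩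
  simpa using (hu (Φ p)).comp Φ.continuous.continuousAt

section
variable {S : Type*} [TopologicalSpace S] [T2Space S] [CompactSpace S]

lemma finish {D : Set S} [PreconnectedSpace D] {z : D} (f : ℕ → ℝ → S)
    (hf : ∀ n, Continuous (f n)) (hi : ∀ n, InjOn (f n) (Icc 0 1)) (hD : IsClosed D)
    (hdis : ∀ n m, n ≠ m → Disjoint (f n '' Icc 0 1 ∩ D) (f m '' Icc 0 1 ∩ D))
    (J : Set ℕ) (hJ : J.Infinite) (s t : ℕ → ℝ) (hst : ∀ n ∈ J, Chd D (f n) (s n) (t n))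
    (hs : ∀ m ∈ J, ∀ n ∈ J, m ≠ n → ∃ q, Sep ((fun x : D => (x : S)) ⁻¹' (f m '' Icc (s m) (t m))) z q ∧
      Sep ((fun x : D => (x : S)) ⁻¹' (f n '' Icc (s n) (t n))) z q) :
    ∃ n : ℕ → ℕ, StrictMono n ∧ ∃ A' : ℕ → Set S,
      (∀ i, IsChord D (A' i) ∧ A' i ⊆ f (n i) '' Icc 0 1 ∩ D) ∧ LinearlyOrderedChords D A' := by
  classical
  haveI := hJ.to_subtype
  let e := Nat.orderEmbeddingOfSet J
  have he : ∀ i, e i ∈ J := fun i => by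
    have := Nat.orderEmbeddingOfSet_range J
    rw [← this]; exact ⟨i, rfl⟩
  let B : ℕ → Set S := fun i => f (e i) '' Icc (s (e i)) (t (e i))
  have hB : ∀ i, B i ⊆ f (e i) '' Icc 0 1 ∩ D := fun i =>
    subset_inter (image_mono (Icc_subset_Icc (hst _ (he i)).s0 (hst _ (he i)).t1))
      ((hst _ (he i)).subD hD)
  have hBd : ∀ i j, i ≠ j → Disjoint (B i) (B j) := fun i j hij =>
    (hdis (e i) (e j) (fun h => hij (e.injective h))).mono (hB i) (hB j)
  let c : ℕ → Set D := fun i => (fun x : D => (x : S)) ⁻¹' B i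
  have hlin := linear_order (z := z) (c := c) ?_ ?_ ?_ ?_
  rotate_left
  · intro n
    have h0 : f (e n) (s (e n)) ∈ B n := ⟨_, left_mem_Icc.2 (hst _ (he n)).lt.le, rfl⟩
    exact ⟨⟨_, (hB n h0).2⟩, h0⟩
  · intro n
    exact pre_preconn (isPreconnected_Icc.image _ (hf _).continuousOn) fun x hx => (hB n hx).2
  · intro m n hmn
    exact (hBd m n hmn).preimage _
  · intro m n hmn
    obtain ⟨q, h1, h2⟩ := hs (e m) (he m) (e n) (he n) fun h => hmn (e.injective h)
    exact ⟨q, h1, h2⟩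
  obtain ⟨g, hg, hord⟩ := hlin
  refine ⟨fun i => e (g i), e.strictMono.comp hg, fun i => B (g i), fun i => ⟨?_, hB _⟩, ?_, ?_⟩
  · exact (hst _ (he _)).isChord hD (hf _) (hi _)
  · intro i j hij
    exact hBd _ _ (hg.injective.ne hij)
  · intro i j k hij hjk x hx y hy heq
    have hxD := (hB _ hx).2
    have hyD := (hB _ hy).2
    obtain ⟨h, h1, h2⟩ := hord i j k hij hjk ⟨x, hxD⟩ hx ⟨y, hyD⟩ hy
    have hxm : x ∈ D \ B (g j) := ⟨hxD, disjoint_left.1 (hBd _ _ (hg hij).ne) hx⟩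
    have hym : y ∈ D \ B (g j) := ⟨hyD, disjoint_left.1 (hBd _ _ (hg hjk).ne') hy⟩
    have hT : IsPreconnected (connectedComponentIn (D \ B (g j)) x) := isPreconnected_connectedComponentIn
    have hTs := connectedComponentIn_subset (D \ B (g j)) x
    have hx' := mem_connectedComponentIn hxm
    have hy' := mem_connectedComponentIn hym
    rw [← heq] at hy'
    have hp := pre_preconn (B := D) hT fun x hx => (hTs hx).1
    exact h2 (LC.const_on hp (fun p hp => h1 p fun hc => (hTs hp).2 hc)
      (x := ⟨x, hxD⟩) (y := ⟨y, hyD⟩) hx' hy')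

lemma core1 (hch : ∀ x : S, ∃ c : Ch S, c.g 0 = x) {d d' : S}
    (hd : d ≠ d') (f : ℕ → ℝ → S) (hf : ∀ n, Continuous (f n)) (hi : ∀ n, InjOn (f n) (Icc 0 1))
    (hf0 : ∀ n, f n 0 = d) (hf1 : ∀ n, f n 1 = d')
    (hdis : ∀ n m, n ≠ m → Disjoint (f n '' Ioo 0 1) (f m '' Icc 0 1))
    {D : Set S} (Φ : D ≃ₜ closedBall (0 : E2) 1) (hdD : d ∉ D) (hdD' : d' ∉ D)
    (hfin : ∀ n, {τ | τ ∈ Icc (0 : ℝ) 1 ∧ f n τ ∈ frontier D}.Finite)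
    (hmeet : ∀ n, (f n '' Icc 0 1 ∩ D).Nonempty) (z : D) (hz : (Φ z : E2) ∈ ball (0 : E2) 1)
    (hzA : ∀ n, (z : S) ∉ f n '' Icc 0 1) :
    ∃ n : ℕ → ℕ, StrictMono n ∧ ∃ A' : ℕ → Set S,
      (∀ i, IsChord D (A' i) ∧ A' i ⊆ f (n i) '' Icc 0 1 ∩ D) ∧ LinearlyOrderedChords D A' := by
  classical
  haveI : CompactSpace D := Φ.symm.compactSpace
  haveI : PreconnectedSpace (closedBall (0 : E2) 1) :=
    isPreconnected_iff_preconnectedSpace.1 (convex_closedBall (0 : E2) 1).isPreconnected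
  haveI : PreconnectedSpace D := ⟨by
    have := isPreconnected_univ.image Φ.symm Φ.symm.continuous.continuousOn
    rwa [image_univ, Φ.symm.surjective.range_eq] at this⟩
  have hD : IsClosed D := (isCompact_iff_compactSpace.2 inferInstance).isClosed
  have hall := allTriv_disc Φ
  have hIoo : ∀ n, ∀ x ∈ f n '' Icc 0 1 ∩ D, x ∈ f n '' Ioo 0 1 := by
    rintro n _ ⟨⟨τ, hτ, rfl⟩, hx⟩
    refine ⟨τ, ⟨lt_of_le_of_ne hτ.1 ?_, lt_of_le_of_ne hτ.2 ?_⟩, rfl⟩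
    · rintro rfl; rw [hf0] at hx; exact hdD hx
    · rintro rfl; rw [hf1] at hx; exact hdD' hx
  have hdisD : ∀ n m, n ≠ m → Disjoint (f n '' Icc 0 1 ∩ D) (f m '' Icc 0 1 ∩ D) := fun n m h =>
    (hdis n m h).mono (fun x hx => hIoo n x hx) inter_subset_left
  choose q0 hq0 using hmeet
  let q : ℕ → D := fun n => ⟨q0 n, (hq0 n).2⟩
  let A : ℕ → Set D := fun n => (fun x : D => (x : S)) ⁻¹' (f n '' Icc 0 1)
  have hAc : ∀ n, IsClosed (A n) := fun n =>
    (isCompact_Icc.image (hf n)).isClosed.preimage continuous_subtype_val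
  have hAd : ∀ n m, n ≠ m → Disjoint (A n) (A m) := fun n m h =>
    disjoint_left.2 fun x hx hx' => disjoint_left.1 (hdisD n m h) ⟨hx, x.2⟩ ⟨hx', x.2⟩
  have hqA : ∀ i j, i ≠ j → (q j : S) ∉ f i '' Icc 0 1 := fun i j h hc =>
    disjoint_left.1 (hdisD i j h) ⟨hc, (q j).2⟩ (hq0 j)
  have hsc := fun n => sep_chord hch Φ (hf n) (hi n) (by rw [hf0]; exact hdD) (by rw [hf1]; exact hdD')
    (hfin n) z hz (hzA n)
  choose P hP hPs using hsc
  let U := hyperfilter ℕ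
  have hU : (U : Filter ℕ) ≤ cofinite := hyperfilter_le_cofinite
  have hne : ∀ i : ℕ, ∀ᶠ j in (U : Filter ℕ), i ≠ j := fun i =>
    hU (mem_cofinite.2 ((Set.finite_singleton i).subset fun x hx => by
      by_contra hc; exact hx fun h => hc h.symm))
  let I : Set ℕ := {i | ∀ᶠ j in (U : Filter ℕ), Sep (A i) z (q j)}
  by_cases hI : I.Infinite
  · have hex : ∀ i, ∃ a : ℝ × ℝ, i ∈ I → Chd D (f i) a.1 a.2 ∧
        ∀ᶠ j in (U : Filter ℕ), Sep ((fun x : D => (x : S)) ⁻¹' (f i '' Icc a.1 a.2)) z (q j) := by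
      intro i
      by_cases hiI : i ∈ I
      · have ev : ∀ᶠ j in (U : Filter ℕ), ∃ a ∈ (P i : Set (ℝ × ℝ)),
            Sep ((fun x : D => (x : S)) ⁻¹' (f i '' Icc a.1 a.2)) z (q j) := by
          filter_upwards [hiI, hne i] with j h1 h2
          exact hPs i (q j) (hqA i j h2) h1
        obtain ⟨a, ha, h⟩ := (Ultrafilter.eventually_exists_mem_iff (P i).finite_toSet).1 ev
        exact ⟨a, fun _ => ⟨hP i a ha, h⟩⟩
      · exact ⟨0, fun h => absurd h hiI⟩
    choose a ha using hex
    refine finish (z := z) f hf hi hD hdisD I hI (fun n => (a n).1) (fun n => (a n).2)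
      (fun n hn => (ha n hn).1) ?_
    intro m hm n hn _
    obtain ⟨j, hj⟩ := ((ha m hm).2.and (ha n hn).2).exists
    exact ⟨q j, hj⟩
  by_cases h2 : ∃ i, {j | i ≠ j ∧ Sep (A j) z (q i)}.Infinite
  · obtain ⟨i, hinf⟩ := h2
    have hex : ∀ j, ∃ a : ℝ × ℝ, j ∈ {j | i ≠ j ∧ Sep (A j) z (q i)} → Chd D (f j) a.1 a.2 ∧
        Sep ((fun x : D => (x : S)) ⁻¹' (f j '' Icc a.1 a.2)) z (q i) := by
      intro j
      by_cases hj : j ∈ {j | i ≠ j ∧ Sep (A j) z (q i)}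
      · obtain ⟨a, ha, h⟩ := hPs j (q i) (hqA j i hj.1.symm) hj.2
        exact ⟨a, fun _ => ⟨hP j a ha, h⟩⟩
      · exact ⟨0, fun h => absurd h hj⟩
    choose a ha using hex
    refine finish (z := z) f hf hi hD hdisD _ hinf (fun n => (a n).1) (fun n => (a n).2)
      (fun n hn => (ha n hn).1) ?_
    intro m hm n hn _
    exact ⟨q i, (ha m hm).2, (ha n hn).2⟩
  exfalso
  push Not at h2
  let r : ℕ → ℕ → Prop := fun i j => i ≠ j ∧ ¬ Sep (A i) z (q j) ∧ ¬ Sep (A j) z (q i)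
  haveI : Std.Symm r := ⟨fun i j h => ⟨h.1.symm, h.2.2, h.2.1⟩⟩
  obtain ⟨g, hg1, hg2⟩ := exists_seq_of_forall_finset_exists' (fun i => i ∉ I) r (by
    intro s hs
    have ev : ∀ᶠ j in (U : Filter ℕ), j ∉ I ∧ ∀ i ∈ s, r i j := by
      refine Filter.Eventually.and (hU ?_) ?_
      · rw [mem_cofinite]
        refine (not_infinite.1 hI).subset fun x hx => ?_
        by_contra hc; exact hx hc
      · rw [Filter.eventually_all_finset]
        intro i his
        have e1 : ∀ᶠ j in (U : Filter ℕ), ¬ Sep (A i) z (q j) :=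
          Ultrafilter.eventually_not.2 (hs i his)
        have e2 : ∀ᶠ j in (U : Filter ℕ), ¬ (i ≠ j ∧ Sep (A j) z (q i)) := by
          refine hU ?_
          rw [mem_cofinite]
          refine (not_infinite.1 (not_infinite.2 (h2 i))).subset fun x hx => ?_
          by_contra hc; exact hx hc
        filter_upwards [hne i, e1, e2] with j h1 h2 h3
        exact ⟨h1, h2, fun h => h3 ⟨h1, h⟩⟩
    exact ev.exists)
  have hr : ∀ m n, m ≠ n → r (g m) (g n) := fun m n h => hg2 h
  refine kpart hch hd (fun n => f (g n)) (fun n => hf _) (fun n => hi _) (fun n => hf0 _) (fun n => hf1 _)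
    (fun n m h => hdis _ _ (hr n m h).1) z (fun n => q (g n)) (fun n => hIoo _ _ (hq0 _)) ?_
  intro i j k hij hik hjk h hh
  by_contra hc
  rcases jan hall (hAc (g i)) (hAc (g j)) (hAd _ _ (hr i j hij).1) (h := fun x : D => h x)
    (fun p hp hp' => (hh p hp hp').comp continuous_subtype_val.continuousAt) hc with hl | hl
  · exact (hr i k hik).2.1 hl
  · exact (hr j k hjk).2.1 hl

lemma core (hch : ∀ x : S, ∃ c : Ch S, c.g 0 = x) {d d' : S}
    (hd : d ≠ d') (f : ℕ → ℝ → S) (hf : ∀ n, Continuous (f n)) (hi : ∀ n, InjOn (f n) (Icc 0 1))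
    (hf0 : ∀ n, f n 0 = d) (hf1 : ∀ n, f n 1 = d')
    (hdis : ∀ n m, n ≠ m → Disjoint (f n '' Ioo 0 1) (f m '' Icc 0 1))
    {D : Set S} (Φ : D ≃ₜ closedBall (0 : E2) 1) (hdD : d ∉ D) (hdD' : d' ∉ D)
    (hfin : ∀ n, {τ | τ ∈ Icc (0 : ℝ) 1 ∧ f n τ ∈ frontier D}.Finite)
    (hmeet : ∀ n, (f n '' Icc 0 1 ∩ D).Nonempty) :
    ∃ n : ℕ → ℕ, StrictMono n ∧ ∃ A' : ℕ → Set S,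
      (∀ i, IsChord D (A' i) ∧ A' i ⊆ f (n i) '' Icc 0 1 ∩ D) ∧ LinearlyOrderedChords D A' := by
  let z : D := Φ.symm ⟨0, by simp⟩
  have hz : (Φ z : E2) ∈ ball (0 : E2) 1 := by simp [z]
  obtain ⟨N, hN⟩ : ∃ N, ∀ n, (z : S) ∉ f (N + n) '' Icc 0 1 := by
    by_cases hex : ∃ n, (z : S) ∈ f n '' Icc 0 1
    · obtain ⟨n, hn⟩ := hex
      refine ⟨n + 1, fun m hm => ?_⟩
      have : (z : S) ∈ f n '' Ioo 0 1 := by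
        obtain ⟨τ, hτ, he⟩ := hn
        refine ⟨τ, ⟨lt_of_le_of_ne hτ.1 ?_, lt_of_le_of_ne hτ.2 ?_⟩, he⟩
        · rintro rfl; rw [hf0] at he; exact hdD (he ▸ z.2)
        · rintro rfl; rw [hf1] at he; exact hdD' (he ▸ z.2)
      exact disjoint_left.1 (hdis n (n + 1 + m) (by omega)) this hm
    · push Not at hex
      exact ⟨0, fun n => hex _⟩
  obtain ⟨n, hn, A', h⟩ := core1 hch hd (fun n => f (N + n)) (fun n => hf _) (fun n => hi _)
    (fun n => hf0 _) (fun n => hf1 _) (fun n m h => hdis _ _ (by omega)) Φ hdD hdD'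
    (fun n => hfin _) (fun n => hmeet _) z hz hN
  exact ⟨fun i => N + n i, fun i j hij => Nat.add_lt_add_left (hn hij) N, A', h⟩

end

end Cradle

/-- A cat's cradle between `d₁` and `d₃` through a closed disk `D₂` in a closed
surface, with each arc meeting the frontier of `D₂` in finitely many points,
admits a subsequence together with sub-chords which are linearly ordered in `D₂`. -/
theorem catsCradle_exists_linearlyOrdered_chords
    {S : Type*} [MetricSpace S] [CompactSpace S] [ConnectedSpace S] [Nonempty S]
    (hS : LocallyEuclidean2 S)
    (d₁ d₃ : S) (hne : d₁ ≠ d₃) (D₂ : Set S) (hD₂ : IsClosedDisk D₂)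
    (A : ℕ → Set S) (hA : IsCatsCradleThrough d₁ d₃ D₂ A)
    (hfin : ∀ n, (A n ∩ frontier D₂).Finite) :
    ∃ n : ℕ → ℕ, StrictMono n ∧ ∃ A' : ℕ → Set S,
      (∀ i, IsChord D₂ (A' i) ∧ A' i ⊆ A (n i) ∩ D₂) ∧
      LinearlyOrderedChords D₂ A' := by
  obtain ⟨⟨harc, hpair⟩, hDd, hmeet⟩ := hA
  choose f0 hf0c hf0i hf0r hf00 hf01 using harc
  obtain ⟨Φ⟩ := hD₂
  have hdD : d₁ ∉ D₂ := fun h => by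
    have : d₁ ∈ D₂ ∩ {d₁, d₃} := ⟨h, by simp⟩
    rw [hDd] at this; exact this
  have hdD' : d₃ ∉ D₂ := fun h => by
    have : d₃ ∈ D₂ ∩ {d₁, d₃} := ⟨h, by simp⟩
    rw [hDd] at this; exact this
  let f : ℕ → ℝ → S := fun n => IccExtend zero_le_one (f0 n)
  have hfe : ∀ n (x : ℝ) (hx : x ∈ Icc (0 : ℝ) 1), f n x = f0 n ⟨x, hx⟩ := fun n x hx =>
    IccExtend_of_mem _ _ hx
  have hf : ∀ n, Continuous (f n) := fun n => (hf0c n).Icc_extend'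
  have hi : ∀ n, InjOn (f n) (Icc 0 1) := by
    intro n x hx y hy h
    rw [hfe n x hx, hfe n y hy] at h
    exact congrArg Subtype.val (hf0i n h)
  have hf0 : ∀ n, f n 0 = d₁ := fun n => by rw [hfe n 0 (by simp)]; exact hf00 n
  have hf1 : ∀ n, f n 1 = d₃ := fun n => by rw [hfe n 1 (by simp)]; exact hf01 n
  have him : ∀ n, f n '' Icc 0 1 = A n := by
    intro n
    rw [← hf0r n]
    ext x
    constructor
    · rintro ⟨t, ht, rfl⟩; exact ⟨⟨t, ht⟩, (hfe n t ht).symm⟩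
    · rintro ⟨t, rfl⟩; exact ⟨t, t.2, hfe n t t.2⟩
  have hdis : ∀ n m, n ≠ m → Disjoint (f n '' Ioo 0 1) (f m '' Icc 0 1) := by
    intro n m hnm
    rw [disjoint_left]
    rintro _ ⟨t, ht, rfl⟩ hx
    have hn1 : f n t ≠ d₁ := fun h => by
      rw [← hf0 n] at h
      exact ht.1.ne' (hi n (Ioo_subset_Icc_self ht) (by simp) h)
    have hn3 : f n t ≠ d₃ := fun h => by
      rw [← hf1 n] at h
      exact ht.2.ne (hi n (Ioo_subset_Icc_self ht) (by simp) h)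
    have hmem : f n t ∈ (A n \ {d₁, d₃}) ∩ (A m \ {d₁, d₃}) := by
      rw [← him n, ← him m]
      exact ⟨⟨⟨t, Ioo_subset_Icc_self ht, rfl⟩, by simp [hn1, hn3]⟩, hx, by simp [hn1, hn3]⟩
    rw [hpair hnm] at hmem
    exact hmem
  have hfin' : ∀ n, {t | t ∈ Icc (0 : ℝ) 1 ∧ f n t ∈ frontier D₂}.Finite := by
    intro n
    refine Set.Finite.of_finite_image (f := f n) ((hfin n).subset ?_) ((hi n).mono fun t ht => ht.1)
    rintro _ ⟨t, ht, rfl⟩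
    exact ⟨him n ▸ ⟨t, ht.1, rfl⟩, ht.2⟩
  obtain ⟨n, hn, A', h1, h2⟩ := Cradle.core (fun x => Cradle.exists_chart hS x) hne f hf hi hf0 hf1 hdis
    Φ hdD hdD' hfin' (fun n => by rw [him]; exact hmeet n)
  exact ⟨n, hn, A', fun i => ⟨(h1 i).1, him (n i) ▸ (h1 i).2⟩, h2⟩
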